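/- arXiv:1212.3036 — 2 statements merged into one kernel-verified Lean document; each statement's English description precedes it below -/
import Mathlib

section
/- Every finite simple claw-free graph G whose vertex set can be partitioned into three cliques satisfies χ(G) ≤ γ_ℓ(G). -/
open SimpleGraph

namespace Paper

variable {V : Type*} {W : Type*}

/-- A graph is claw-free if no vertex has three pairwise nonadjacent neighbours. -/
def ClawFree (G : SimpleGraph V) : Prop :=
  ¬ ∃ (v a b c : V), G.Adj v a ∧ G.Adj v b ∧ G.Adj v c ∧
      ¬G.Adj a b ∧ ¬G.Adj a c ∧ ¬G.Adj b c ∧ a ≠ b ∧ a ≠ c ∧ b ≠ c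

/-- A graph is quasi-line if every neighbourhood is covered by two cliques. -/
def QuasiLine (G : SimpleGraph V) : Prop :=
  ∀ v : V, ∃ S T : Set V, G.IsClique S ∧ G.IsClique T ∧ G.neighborSet v ⊆ S ∪ T

/-- The clique number ω(G). -/
noncomputable def cliqueNum (G : SimpleGraph V) : ℕ :=
  sSup {n | ∃ s : Finset V, G.IsNClique n s}

/-- The clique number of the subgraph induced on a vertex set `S`. -/
noncomputable def cliqueNumOn (G : SimpleGraph V) (S : Set V) : ℕ :=
  sSup {n | ∃ s : Finset V, ↑s ⊆ S ∧ G.IsNClique n s}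

/-- ω(v): the maximum size of a clique containing `v`. -/
noncomputable def omegaAt (G : SimpleGraph V) (v : V) : ℕ :=
  sSup {n | ∃ s : Finset V, G.IsNClique n s ∧ v ∈ s}

/-- The degree of a vertex (as the cardinality of its neighbourhood). -/
noncomputable def degree' (G : SimpleGraph V) (v : V) : ℕ := (G.neighborSet v).ncard

/-- The maximum degree Δ(G). -/
noncomputable def maxDeg (G : SimpleGraph V) : ℕ := sSup {n | ∃ v : V, n = degree' G v}

/-- γ_ℓ(v) = ⌈(d(v)+1+ω(v))/2⌉. -/
noncomputable def gammaLocalAt (G : SimpleGraph V) (v : V) : ℕ :=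
  (degree' G v + 1 + omegaAt G v + 1) / 2

/-- γ_ℓ(G) = max over vertices of γ_ℓ(v). -/
noncomputable def gammaLocal (G : SimpleGraph V) : ℕ :=
  sSup {n | ∃ v : V, n = gammaLocalAt G v}

/-- The closed neighbourhood of a vertex. -/
def closedNbhd (G : SimpleGraph V) (v : V) : Set V := insert v (G.neighborSet v)

/-- The closed neighbourhood within an induced subgraph on `S`. -/
def closedNbhdOn (G : SimpleGraph V) (S : Set V) (v : V) : Set V := S ∩ closedNbhd G v

/-- A triad: three pairwise nonadjacent vertices. -/
def IsTriad (G : SimpleGraph V) (T : Finset V) : Prop :=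
  T.card = 3 ∧ ∀ u ∈ T, ∀ w ∈ T, u ≠ w → ¬G.Adj u w

/-- A good triad within the induced subgraph on `S`: every vertex of the induced subgraph
outside `T` has two neighbours in `T`, or a twin in `T`, or is trumped by a vertex of `T`. -/
def GoodTriadOn (G : SimpleGraph V) (S : Set V) (T : Finset V) : Prop :=
  ↑T ⊆ S ∧ IsTriad G T ∧
    ∀ v ∈ S, v ∉ T →
      (∃ t1 ∈ T, ∃ t2 ∈ T, t1 ≠ t2 ∧ G.Adj v t1 ∧ G.Adj v t2) ∨
      (∃ t ∈ T, closedNbhdOn G S v = closedNbhdOn G S t) ∨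
      (∃ t ∈ T, closedNbhdOn G S v ⊂ closedNbhdOn G S t)

/-- A good triad in `G`. -/
def GoodTriad (G : SimpleGraph V) (T : Finset V) : Prop := GoodTriadOn G Set.univ T

/-- A homogeneous pair of cliques within the induced subgraph on `S`. -/
def IsHomPairOn (G : SimpleGraph V) (S : Set V) (A B : Finset V) : Prop :=
  ↑A ⊆ S ∧ ↑B ⊆ S ∧ G.IsClique (↑A : Set V) ∧ G.IsClique (↑B : Set V) ∧
    A.Nonempty ∧ B.Nonempty ∧ Disjoint A B ∧ 3 ≤ A.card + B.card ∧
    ∀ v ∈ S, v ∉ A → v ∉ B →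
      ((∀ a ∈ A, G.Adj v a) ∨ (∀ a ∈ A, ¬G.Adj v a)) ∧
      ((∀ b ∈ B, G.Adj v b) ∨ (∀ b ∈ B, ¬G.Adj v b))

/-- A homogeneous pair of cliques in `G`. -/
def IsHomPair (G : SimpleGraph V) (A B : Finset V) : Prop := IsHomPairOn G Set.univ A B

/-- A homogeneous pair of cliques `(A,B)` is skeletal if deleting any single edge
between `A` and `B` strictly decreases the clique number of `G[A ∪ B]`. -/
def IsSkeletalPair (G : SimpleGraph V) (A B : Finset V) : Prop :=
  ∀ a ∈ A, ∀ b ∈ B, G.Adj a b →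
    cliqueNumOn (G.deleteEdges {s(a, b)}) (↑A ∪ ↑B) < cliqueNumOn G (↑A ∪ ↑B)

/-- A graph is skeletal if every homogeneous pair of cliques in it is skeletal. -/
def Skeletal (G : SimpleGraph V) : Prop :=
  ∀ A B : Finset V, IsHomPair G A B → IsSkeletalPair G A B

/-- A linear pair: no induced C₄ between `A` and `B`. -/
def IsLinearPair (G : SimpleGraph V) (A B : Finset V) : Prop :=
  ¬ ∃ a1 ∈ A, ∃ a2 ∈ A, ∃ b1 ∈ B, ∃ b2 ∈ B,
      G.Adj a1 b1 ∧ G.Adj a2 b2 ∧ ¬G.Adj a1 b2 ∧ ¬G.Adj a2 b1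

/-- A homogeneous clique. -/
def IsHomogeneousClique [Fintype V] (G : SimpleGraph V) (C : Finset V) : Prop :=
  G.IsClique (↑C : Set V) ∧ 2 ≤ C.card ∧ C.card ≤ Fintype.card V - 1 ∧
    ∀ v ∉ C, (∀ c ∈ C, G.Adj v c) ∨ (∀ c ∈ C, ¬G.Adj v c)

/-- `X` straddles the three-cliquing `(A,B,C)` if it meets more than one of `A`, `B`, `C`. -/
def Straddles (A B C : Set V) (X : Finset V) : Prop :=
  ((↑X ∩ A).Nonempty ∧ (↑X ∩ B).Nonempty) ∨
  ((↑X ∩ A).Nonempty ∧ (↑X ∩ C).Nonempty) ∨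
  ((↑X ∩ B).Nonempty ∧ (↑X ∩ C).Nonempty)

/-- A three-cliqued graph is weakly skeletal if every nonskeletal homogeneous pair
of cliques is straddling. -/
def WeaklySkeletal (G : SimpleGraph V) (A B C : Set V) : Prop :=
  ∀ X Y : Finset V, IsHomPair G X Y → ¬IsSkeletalPair G X Y →
    Straddles A B C X ∨ Straddles A B C Y

/-- A set of unordered pairs forming a matching (pairwise disjoint non-loop pairs). -/
def IsMatchingSet (M : Set (Sym2 W)) : Prop :=
  (∀ e ∈ M, ¬e.IsDiag) ∧ ∀ e ∈ M, ∀ e' ∈ M, e ≠ e' → ∀ w : W, w ∈ e → w ∉ e'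

/-- `G[D]` is a thickening of `H[R]` under the matching `M`, via the fiber map `f`. -/
structure IsThickeningBetween (H : SimpleGraph W) (M : Set (Sym2 W)) (R : Set W)
    (G : SimpleGraph V) (D : Set V) (f : V → W) : Prop where
  maps_into : ∀ v ∈ D, f v ∈ R
  fibers_nonempty : ∀ w ∈ R, ∃ v ∈ D, f v = w
  fibers_clique : ∀ w : W, G.IsClique {v | v ∈ D ∧ f v = w}
  adj_of_adj : ∀ u ∈ D, ∀ v ∈ D, f u ≠ f v → H.Adj (f u) (f v) → s(f u, f v) ∉ M → G.Adj u v
  nonadj_of_nonadj : ∀ u ∈ D, ∀ v ∈ D, f u ≠ f v → ¬H.Adj (f u) (f v) → ¬G.Adj u v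
  semi_adj : ∀ x ∈ R, ∀ y ∈ R, s(x, y) ∈ M →
    ∃ u ∈ D, ∃ v ∈ D, f u = x ∧ f v = y ∧ G.Adj u v
  semi_nonadj : ∀ x ∈ R, ∀ y ∈ R, s(x, y) ∈ M →
    ∃ u ∈ D, ∃ v ∈ D, f u = x ∧ f v = y ∧ ¬G.Adj u v

/-- `G` is a thickening of `H[R]` under `M`. -/
def IsThickeningOn (H : SimpleGraph W) (M : Set (Sym2 W)) (R : Set W)
    (G : SimpleGraph V) (f : V → W) : Prop :=
  IsThickeningBetween H M R G Set.univ f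

/-- `G` is a thickening of `H` under `M`. -/
def IsThickening (H : SimpleGraph W) (M : Set (Sym2 W)) (G : SimpleGraph V) (f : V → W) : Prop :=
  IsThickeningBetween H M Set.univ G Set.univ f

/-- A graph is antiprismatic if every vertex outside a triad has exactly two
neighbours in it. -/
def Antiprismatic (H : SimpleGraph W) : Prop :=
  ∀ T : Finset W, IsTriad H T → ∀ v ∉ T,
    ∃ t ∈ T, ¬H.Adj v t ∧ ∀ t' ∈ T, t' ≠ t → H.Adj v t'

/-- A changeable matching in an antiprismatic graph. -/
def ChangeableMatching (H : SimpleGraph W) (M : Set (Sym2 W)) : Prop :=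
  M ⊆ H.edgeSet ∧ IsMatchingSet M ∧ ∀ M' ⊆ M, Antiprismatic (H.deleteEdges M')



/-- The icosahedron `G0` on vertices `v0, …, v11`. -/
def icoG0 : SimpleGraph (Fin 12) :=
  SimpleGraph.fromRel (fun i j =>
    (1 ≤ i.val ∧ i.val ≤ 10 ∧ (j.val = i.val % 10 + 1 ∨ j.val = (i.val + 1) % 10 + 1)) ∨
    (i.val = 0 ∧ j.val % 2 = 1 ∧ 1 ≤ j.val ∧ j.val ≤ 10) ∨
    (i.val = 11 ∧ j.val % 2 = 0 ∧ 1 ≤ j.val ∧ j.val ≤ 10))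

/-- `G1 = G0 − v11`. -/
def icoG1 : SimpleGraph (Fin 11) :=
  SimpleGraph.fromRel (fun i j =>
    (1 ≤ i.val ∧ (j.val = i.val % 10 + 1 ∨ j.val = (i.val + 1) % 10 + 1)) ∨
    (i.val = 0 ∧ j.val % 2 = 1))

/-- `G2 = G1 − v10`. -/
def icoG2 : SimpleGraph (Fin 10) :=
  SimpleGraph.fromRel (fun i j =>
    (1 ≤ i.val ∧ (j.val = i.val % 10 + 1 ∨ j.val = (i.val + 1) % 10 + 1)) ∨
    (i.val = 0 ∧ j.val % 2 = 1))

/-- An icosahedral thickening: a proper thickening of `G0` or `G1`, or a thickening of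
`G2 ∪ M` under a matching `M ⊆ {v1v4, v6v9}`. -/
def IsIcosahedralThickening (G : SimpleGraph V) : Prop :=
  (∃ f : V → Fin 12, IsThickening icoG0 ∅ G f) ∨
  (∃ f : V → Fin 11, IsThickening icoG1 ∅ G f) ∨
  (∃ (M : Set (Sym2 (Fin 10))) (f : V → Fin 10),
      M ⊆ {s((1 : Fin 10), 4), s(6, 9)} ∧
      IsThickening (icoG2 ⊔ SimpleGraph.fromEdgeSet M) M G f)

/-! ### Antihat graphs -/

/-- The vertex type of the antihat base graph: `A = {a0,…,ak}`, `B = {b0,…,bk}`,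
`C = {c1,…,ck}` (the third component `i` encodes `c_{i+1}`). -/
abbrev AHV (k : ℕ) : Type := Fin (k + 1) ⊕ Fin (k + 1) ⊕ Fin k

def ahA {k : ℕ} (i : Fin (k + 1)) : AHV k := Sum.inl i
def ahB {k : ℕ} (i : Fin (k + 1)) : AHV k := Sum.inr (Sum.inl i)
def ahC {k : ℕ} (i : Fin k) : AHV k := Sum.inr (Sum.inr i)

/-- The antihat base graph `H`, where `e00` records whether `a0` and `b0` are adjacent. -/
def antihatH (k : ℕ) (e00 : Bool) : SimpleGraph (AHV k) :=
  SimpleGraph.fromRel (fun x y =>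
    match x, y with
    | Sum.inl _, Sum.inl _ => True
    | Sum.inr (Sum.inl _), Sum.inr (Sum.inl _) => True
    | Sum.inr (Sum.inr _), Sum.inr (Sum.inr _) => True
    | Sum.inl i, Sum.inr (Sum.inl j) =>
        (i = j ∧ 1 ≤ i.val) ∨ (i.val = 0 ∧ j.val = 0 ∧ e00 = true)
    | Sum.inl i, Sum.inr (Sum.inr j) => 1 ≤ i.val ∧ i.val ≠ j.val + 1
    | Sum.inr (Sum.inl i), Sum.inr (Sum.inr j) => 1 ≤ i.val ∧ i.val ≠ j.val + 1
    | _, _ => False)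

/-- The conditions on the matching `M` of an antihat thickening with deleted set `Xd`. -/
def AntihatM (k : ℕ) (e00 : Bool) (Xd : Finset (AHV k)) (M : Set (Sym2 (AHV k))) : Prop :=
  IsMatchingSet M ∧
  (∀ e ∈ M, ∀ w : AHV k, w ∈ e → w ∉ Xd) ∧
  (∀ i j : Fin (k + 1), s(ahA i, ahA j) ∉ M) ∧
  (∀ i j : Fin (k + 1), s(ahB i, ahB j) ∉ M) ∧
  (∀ i j : Fin k, s(ahC i, ahC j) ∉ M) ∧
  (e00 = true → s(ahA (0 : Fin (k + 1)), ahB (0 : Fin (k + 1))) ∈ M) ∧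
  (∀ i j : Fin (k + 1), 1 ≤ i.val → 1 ≤ j.val → s(ahA i, ahB j) ∈ M →
      i = j ∧ ∃ c : Fin k, c.val + 1 = i.val ∧ ahC c ∈ Xd) ∧
  (∀ i : Fin (k + 1), ∀ j : Fin k, 1 ≤ i.val → s(ahB i, ahC j) ∈ M →
      i.val = j.val + 1 ∧ ahA i ∈ Xd) ∧
  (∀ i : Fin (k + 1), ∀ j : Fin k, 1 ≤ i.val → s(ahA i, ahC j) ∈ M →
      i.val = j.val + 1 ∧ ahB i ∈ Xd)

/-! ### Strips and generalized 2-joins -/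

/-- The induced subgraph on `S` contains an induced `W5` (a 5-wheel). -/
def HasInducedW5On (G : SimpleGraph V) (S : Set V) : Prop :=
  ∃ w c0 c1 c2 c3 c4 : V,
    w ∈ S ∧ c0 ∈ S ∧ c1 ∈ S ∧ c2 ∈ S ∧ c3 ∈ S ∧ c4 ∈ S ∧
    G.Adj w c0 ∧ G.Adj w c1 ∧ G.Adj w c2 ∧ G.Adj w c3 ∧ G.Adj w c4 ∧
    G.Adj c0 c1 ∧ G.Adj c1 c2 ∧ G.Adj c2 c3 ∧ G.Adj c3 c4 ∧ G.Adj c4 c0 ∧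
    c0 ≠ c2 ∧ c0 ≠ c3 ∧ c1 ≠ c3 ∧ c1 ≠ c4 ∧ c2 ≠ c4 ∧
    ¬G.Adj c0 c2 ∧ ¬G.Adj c0 c3 ∧ ¬G.Adj c1 c3 ∧ ¬G.Adj c1 c4 ∧ ¬G.Adj c2 c4

/-- A generalized 2-join `((X1,Y1),(X2,Y2))` of `G` separating `V1` from `V2`,
with `X1, X2, Y1, Y2` pairwise disjoint except possibly `X1` and `Y1`. -/
structure IsGen2Join [Fintype V] [DecidableEq V] (G : SimpleGraph V)
    (V1 V2 X1 Y1 X2 Y2 : Finset V) : Prop where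
  disjV : Disjoint V1 V2
  unionV : V1 ∪ V2 = Finset.univ
  subX1 : X1 ⊆ V1
  subY1 : Y1 ⊆ V1
  subX2 : X2 ⊆ V2
  subY2 : Y2 ⊆ V2
  cliqueX : G.IsClique (↑X1 ∪ ↑X2 : Set V)
  cliqueY : G.IsClique (↑Y1 ∪ ↑Y2 : Set V)
  cross : ∀ u ∈ V1, ∀ v ∈ V2, G.Adj u v → (u ∈ X1 ∧ v ∈ X2) ∨ (u ∈ Y1 ∧ v ∈ Y2)
  disjX2Y2 : Disjoint X2 Y2

/-- ω'(v): the maximum size of a clique of `H2 = G[V2 ∪ X1 ∪ Y1]` containing `v`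
and not intersecting both `X1 ∖ Y1` and `Y1 ∖ X1`. -/
noncomputable def omegaJ [DecidableEq V] (G : SimpleGraph V) (V2 X1 Y1 : Finset V) (v : V) : ℕ :=
  sSup {n | ∃ s : Finset V, G.IsNClique n s ∧ v ∈ s ∧ s ⊆ V2 ∪ X1 ∪ Y1 ∧
      ¬((∃ x ∈ s, x ∈ X1 ∧ x ∉ Y1) ∧ ∃ y ∈ s, y ∈ Y1 ∧ y ∉ X1)}

/-- γ_ℓ^j(H2) = max over `v ∈ V2 ∪ X1 ∪ Y1` of ⌈(d_G(v)+1+ω'(v))/2⌉. -/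
noncomputable def gammaLJ [DecidableEq V] (G : SimpleGraph V) (V2 X1 Y1 : Finset V) : ℕ :=
  (V2 ∪ X1 ∪ Y1).sup fun v => (degree' G v + 1 + omegaJ G V2 X1 Y1 v + 1) / 2

/-- `(G[V2], X2, Y2)` is an antihat strip. -/
def IsAntihatStripOn (G : SimpleGraph V) (V2 X2 Y2 : Finset V) : Prop :=
  ∃ (k : ℕ) (e00 : Bool) (Xd : Finset (AHV k)) (M : Set (Sym2 (AHV k))) (f : V → AHV k),
    2 ≤ k ∧ ahA (0 : Fin (k + 1)) ∉ Xd ∧ ahB (0 : Fin (k + 1)) ∉ Xd ∧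
    (∃ i j : Fin k, i ≠ j ∧ ahC i ∉ Xd ∧ ahC j ∉ Xd) ∧
    AntihatM k e00 Xd M ∧
    IsThickeningBetween (antihatH k e00 ⊔ SimpleGraph.fromEdgeSet M) M
      ((↑Xd ∪ {ahA (0 : Fin (k + 1)), ahB (0 : Fin (k + 1))} : Set (AHV k))ᶜ)
      G (↑V2 : Set V) f ∧
    (↑X2 : Set V) = {v | v ∈ V2 ∧ ∃ i : Fin (k + 1), 1 ≤ i.val ∧ f v = ahA i ∧ ahA i ∉ Xd} ∧
    (↑Y2 : Set V) = {v | v ∈ V2 ∧ ∃ i : Fin (k + 1), 1 ≤ i.val ∧ f v = ahB i ∧ ahB i ∉ Xd} ∧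
    HasInducedW5On G (↑V2 : Set V)

/-- The base graph of strange strips, on `a1=0, a2=1, b1=2, b2=3, b3=4, c1=5, c2=6`. -/
def strangeH : SimpleGraph (Fin 7) :=
  SimpleGraph.fromEdgeSet
    {s(0, 1), s(2, 3), s(2, 4), s(3, 4), s(5, 6),
     s(0, 2), s(1, 5), s(3, 5), s(4, 5), s(0, 6), s(1, 6), s(2, 6), s(3, 6)}

/-- The matching `{b3c1, b2c2}` of strange strips. -/
def strangeM : Set (Sym2 (Fin 7)) := {s(4, 5), s(3, 6)}

/-- `(G[V2], X2, Y2)` is a strange strip. -/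
def IsStrangeStripOn (G : SimpleGraph V) (V2 X2 Y2 : Finset V) : Prop :=
  ∃ f : V → Fin 7,
    IsThickeningBetween strangeH strangeM Set.univ G (↑V2 : Set V) f ∧
    (↑X2 : Set V) = {v | v ∈ V2 ∧ (f v = 0 ∨ f v = 1)} ∧
    (↑Y2 : Set V) = {v | v ∈ V2 ∧ (f v = 2 ∨ f v = 3 ∨ f v = 4)}

/-- The base graph of gear strips, on `v1, …, v10` (as `0, …, 9`). -/
def gearH : SimpleGraph (Fin 10) :=
  SimpleGraph.fromEdgeSet
    {s(0, 1), s(1, 2), s(2, 3), s(3, 4), s(4, 5), s(0, 5),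
     s(6, 0), s(6, 1), s(6, 2), s(6, 5),
     s(7, 2), s(7, 3), s(7, 4), s(7, 5), s(7, 6),
     s(8, 0), s(8, 2), s(8, 3), s(8, 5), s(8, 6), s(8, 7),
     s(9, 1), s(9, 2), s(9, 4), s(9, 5), s(9, 6), s(9, 7)}

/-- `(G[V2], X2, Y2)` is a gear strip. -/
def IsGearStripOn (G : SimpleGraph V) (V2 X2 Y2 : Finset V) : Prop :=
  ∃ (Xd : Finset (Fin 10)) (M : Set (Sym2 (Fin 10))) (f : V → Fin 10),
    Xd ⊆ {8, 9} ∧ M ⊆ {s((6 : Fin 10), 7)} ∧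
    IsThickeningBetween gearH M ((↑Xd : Set (Fin 10))ᶜ) G (↑V2 : Set V) f ∧
    (↑X2 : Set V) = {v | v ∈ V2 ∧ (f v = 0 ∨ f v = 1)} ∧
    (↑Y2 : Set V) = {v | v ∈ V2 ∧ (f v = 3 ∨ f v = 4)}

/-! ### The two exceptional three-cliqued classes -/

/-- The base graph of Exception I, on `v1, …, v8` (as `0, …, 7`);
`b` records whether `v2v5` is an edge. -/
def exIG (b : Bool) : SimpleGraph (Fin 8) :=
  SimpleGraph.fromEdgeSet
    ({s(0, 1), s(0, 2), s(0, 5), s(0, 6), s(1, 2), s(1, 3), s(2, 3), s(2, 4), s(3, 4),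
      s(3, 5), s(4, 5), s(5, 6), s(6, 7)} ∪ (if b then {s(1, 4)} else ∅))

/-- The matching of Exception I: `{v1v4, v3v6}`, plus `v2v5` when present. -/
def exIM (b : Bool) : Set (Sym2 (Fin 8)) :=
  {s(0, 3), s(2, 5)} ∪ (if b then {s(1, 4)} else ∅)

/-- The base graph of Exception II, on `v1, …, v9` (as `0, …, 8`); `b24` records
whether `v2v4` is an edge and `b75` whether `v7v5` is an edge. -/
def exIIG (b24 b75 : Bool) : SimpleGraph (Fin 9) :=
  SimpleGraph.fromEdgeSet
    ({s(0, 1), s(6, 7),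
      s(2, 3), s(2, 4), s(2, 5), s(2, 8), s(3, 4), s(3, 5), s(3, 8), s(4, 5), s(4, 8), s(5, 8),
      s(0, 2), s(0, 7), s(0, 8), s(5, 7), s(7, 8), s(1, 2), s(5, 6)}
      ∪ (if b24 then {s(1, 3)} else ∅) ∪ (if b75 then {s(4, 6)} else ∅))

/-! ### Circular interval representations -/

/-- Membership in the (closed) arc from `s` to `t` of the circle `[0,1)`,
going in increasing direction and possibly wrapping around. -/
def ArcMem (s t x : ℝ) : Prop := if s ≤ t then s ≤ x ∧ x ≤ t else (s ≤ x ∨ x ≤ t)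

section Aux
open scoped Classical


/-- `X` has a perfect matching in `H`. -/
def PM {V : Type*} (H : SimpleGraph V) (X : Finset V) : Prop :=
  ∃ f : V → V, ∀ x ∈ X, f x ∈ X ∧ H.Adj x (f x) ∧ f (f x) = x

lemma PM.empty {V : Type*} (H : SimpleGraph V) : PM H ∅ := ⟨id, by simp⟩

lemma PM.pair {V : Type*} {H : SimpleGraph V} {p q : V} (h : H.Adj p q) : PM H {p, q} := by
  refine ⟨fun x => if x = p then q else p, ?_⟩
  have hne := h.ne
  intro x hx
  simp only [Finset.mem_insert, Finset.mem_singleton] at hx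
  rcases hx with rfl | rfl
  · simp [h, hne.symm]
  · simp [h.symm, hne.symm]

lemma PM.union {V : Type*} {H : SimpleGraph V} {X Y : Finset V} (hX : PM H X) (hY : PM H Y)
    (hd : Disjoint X Y) : PM H (X ∪ Y) := by
  obtain ⟨f, hf⟩ := hX
  obtain ⟨g, hg⟩ := hY
  refine ⟨fun x => if x ∈ X then f x else g x, ?_⟩
  intro x hx
  by_cases hxX : x ∈ X
  · obtain ⟨h1, h2, h3⟩ := hf x hxX
    simp [hxX, h1, h2, h3]
  · have hxY : x ∈ Y := by
      rcases Finset.mem_union.1 hx with h | h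
      · exact absurd h hxX
      · exact h
    obtain ⟨h1, h2, h3⟩ := hg x hxY
    have : g x ∉ X := fun h => Finset.disjoint_left.1 hd h h1
    simp [hxX, h1, h2, h3, this]

lemma PM.biUnion {V ι : Type*} {H : SimpleGraph V} (s : Finset ι) (g : ι → Finset V)
    (h : ∀ i ∈ s, PM H (g i)) (hd : ∀ i ∈ s, ∀ j ∈ s, i ≠ j → Disjoint (g i) (g j)) :
    PM H (s.biUnion g) := by
  induction s using Finset.induction_on with
  | empty => simpa using PM.empty H
  | insert a s ha ih =>
    rw [Finset.biUnion_insert]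
    refine PM.union (h a (by simp)) (ih (fun i hi => h i (by simp [hi]))
      (fun i hi j hj => hd i (by simp [hi]) j (by simp [hj]))) ?_
    rw [Finset.disjoint_biUnion_right]
    intro i hi
    exact hd a (by simp) i (by simp [hi]) (fun h => ha (h ▸ hi))

lemma PM.even {V : Type*} {H : SimpleGraph V} {X : Finset V} (h : PM H X) : Even X.card := by
  obtain ⟨f, hf⟩ := h
  have : ((X.card : ℕ) : ZMod 2) = 0 := by
    rw [Finset.cast_card]
    refine Finset.sum_involution (fun x _ => f x) ?_ ?_ ?_ ?_
    · intro a ha; decide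
    · intro a ha _ h; exact (hf a ha).2.1.ne h.symm
    · intro a ha; exact (hf a ha).1
    · intro a ha; exact (hf a ha).2.2
  exact (ZMod.natCast_eq_zero_iff_even).1 this

lemma PM.remove_two {V : Type*} {H : SimpleGraph V} {X : Finset V} (h : PM H X) {p q : V}
    (hp : p ∈ X) (hq : q ∈ X) (hpq : p ≠ q) :
    PM H (X \ {p, q}) ∨ ∃ p' q', p' ≠ q' ∧ p' ∈ X \ {p, q} ∧ q' ∈ X \ {p, q} ∧
      PM H ((X \ {p, q}) \ {p', q'}) := by
  obtain ⟨f, hf⟩ := h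
  have hp' := hf p hp
  have hq' := hf q hq
  by_cases hm : f p = q
  · left
    refine ⟨f, ?_⟩
    intro x hx
    simp only [Finset.mem_sdiff, Finset.mem_insert, Finset.mem_singleton, not_or] at hx ⊢
    have := hf x hx.1
    grind
  · right
    have n1 := hp'.2.1.ne
    have n2 := hq'.2.1.ne
    refine ⟨f p, f q, by grind, ?_, ?_, f, ?_⟩
    · simp only [Finset.mem_sdiff, Finset.mem_insert, Finset.mem_singleton, not_or]
      grind
    · simp only [Finset.mem_sdiff, Finset.mem_insert, Finset.mem_singleton, not_or]
      grind
    · intro x hx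
      simp only [Finset.mem_sdiff, Finset.mem_insert, Finset.mem_singleton, not_or] at hx ⊢
      have := hf x hx.1.1
      grind

lemma tutte_fin {V : Type*} (H : SimpleGraph V) (W : Finset V) (hev : Even W.card)
    (hn : ¬ PM H W) : ∃ U ⊆ W, ∃ 𝒪 : Finset (Finset V), U.card + 2 ≤ 𝒪.card ∧
      (∀ O ∈ 𝒪, O ⊆ W \ U ∧ Odd O.card ∧ ∀ x ∈ O, ∀ y ∈ W, H.Adj x y → y ∈ O ∨ y ∈ U) ∧
      (∀ O ∈ 𝒪, ∀ O' ∈ 𝒪, O ≠ O' → Disjoint O O') := by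
  let G' : SimpleGraph W := H.induce (W : Set V)
  have hno : ¬ ∃ M : Subgraph G', M.IsPerfectMatching := by
    rintro ⟨M, hM⟩
    rw [Subgraph.isPerfectMatching_iff] at hM
    choose m hm hm' using hM
    apply hn
    refine ⟨fun x => if h : x ∈ W then (m ⟨x, h⟩ : V) else x, ?_⟩
    intro x hx
    have h1 := hm ⟨x, hx⟩
    have h2 : m (m ⟨x, hx⟩) = ⟨x, hx⟩ := (hm' _ _ h1.symm).symm
    have h3 : G'.Adj _ _ := h1.adj_sub
    simp only [hx, dif_pos, Finset.coe_mem, true_and]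
    refine ⟨h3, ?_⟩
    simp [h2]
  rw [SimpleGraph.tutte] at hno
  push Not at hno
  obtain ⟨u, hu⟩ := hno
  unfold IsTutteViolator at hu
  set K := ((⊤ : G'.Subgraph).deleteVerts u).coe with hK
  have hmemv : ∀ x : W, x ∈ ((⊤ : G'.Subgraph).deleteVerts u).verts ↔ x ∉ u := by
    intro x; simp
  have hpar := SimpleGraph.odd_ncard_oddComponents K
  have hcard : Nat.card ((⊤ : G'.Subgraph).deleteVerts u).verts + u.ncard = W.card := by
    have : ((⊤ : G'.Subgraph).deleteVerts u).verts = uᶜ := by ext x; simp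
    rw [this, Nat.card_coe_set_eq, add_comm, Set.ncard_add_ncard_compl]
    simp
  have hge : u.ncard + 2 ≤ K.oddComponents.ncard := by
    by_contra hlt
    have heq : K.oddComponents.ncard = u.ncard + 1 := by omega
    rw [heq] at hpar
    rw [← hcard] at hev
    rcases Nat.even_or_odd u.ncard with h | h
    · have := hpar.1 h.add_one
      rw [Nat.even_add] at hev
      rw [← Nat.not_even_iff_odd] at this
      tauto
    · have h2 : ¬ Odd (u.ncard + 1) := by rw [Nat.not_odd_iff_even]; exact h.add_one
      have := mt hpar.2 h2
      rw [Nat.even_add] at hev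
      rw [Nat.not_odd_iff_even] at this
      rw [← Nat.not_even_iff_odd] at h
      tauto
  let emb : ((⊤ : G'.Subgraph).deleteVerts u).verts → V := fun x => x.1.1
  have hemb : Function.Injective emb := fun x y h => Subtype.ext (Subtype.ext h)
  let toF : K.ConnectedComponent → Finset V := fun c => c.supp.toFinset.image emb
  have htoF : ∀ c x, emb x ∈ toF c ↔ K.connectedComponentMk x = c := by
    intro c x
    simp only [toF, Finset.mem_image, Set.mem_toFinset, ConnectedComponent.mem_supp_iff]
    constructor
    · rintro ⟨y, hy, hxy⟩
      rw [← hemb hxy]; exact hy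
    · intro h; exact ⟨x, h, rfl⟩
  have hmem : ∀ c v, v ∈ toF c → ∃ x, emb x = v := by
    intro c v hv
    simp only [toF, Finset.mem_image] at hv
    obtain ⟨x, _, hx⟩ := hv
    exact ⟨x, hx⟩
  have hinj : Function.Injective toF := by
    intro c d hcd
    obtain ⟨x, hx⟩ := c.nonempty_supp
    have h1 : emb x ∈ toF c := (htoF c x).2 hx
    rw [hcd, htoF] at h1
    exact hx.symm.trans h1
  have hfin : K.oddComponents.Finite := Set.toFinite _
  refine ⟨u.toFinset.image Subtype.val, ?_, hfin.toFinset.image toF, ?_, ?_, ?_⟩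
  · intro x hx
    simp only [Finset.mem_image] at hx
    obtain ⟨y, _, rfl⟩ := hx
    exact y.2
  · rw [Finset.card_image_of_injective _ hinj, Finset.card_image_of_injective _ Subtype.val_injective,
      ← Set.ncard_eq_toFinset_card _ hfin, ← Set.ncard_eq_toFinset_card']
    exact hge
  · intro O hO
    simp only [Finset.mem_image, Set.Finite.mem_toFinset] at hO
    obtain ⟨c, hc, rfl⟩ := hO
    refine ⟨?_, ?_, ?_⟩
    · intro v hv
      obtain ⟨x, rfl⟩ := hmem _ _ hv
      have := (hmemv x.1).1 x.2
      simp only [Finset.mem_sdiff, Finset.mem_image, Set.mem_toFinset]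
      refine ⟨x.1.2, ?_⟩
      rintro ⟨y, hy, hyx⟩
      have : y = x.1 := Subtype.ext hyx
      subst this
      contradiction
    · simp only [toF]
      rw [Finset.card_image_of_injective _ hemb, ← Set.ncard_eq_toFinset_card']
      exact hc
    · intro v hv y hy hadj
      obtain ⟨x, rfl⟩ := hmem _ _ hv
      by_cases hyu : (⟨y, hy⟩ : W) ∈ u
      · right
        simp only [Finset.mem_image, Set.mem_toFinset]
        exact ⟨_, hyu, rfl⟩
      · left
        let y' : ((⊤ : G'.Subgraph).deleteVerts u).verts := ⟨⟨y, hy⟩, (hmemv _).2 hyu⟩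
        have hy' : emb y' = y := rfl
        rw [← hy', htoF]
        rw [htoF] at hv
        rw [← hv]
        apply ConnectedComponent.sound
        apply Adj.reachable
        have hx := (hmemv x.1).1 x.2
        rw [hK, Subgraph.coe_adj, Subgraph.deleteVerts_adj]
        refine ⟨by simp, hyu, by simp, hx, ?_⟩
        rw [Subgraph.top_adj]
        exact hadj.symm
  · intro O hO O' hO' hne
    simp only [Finset.mem_image, Set.Finite.mem_toFinset] at hO hO'
    obtain ⟨c, hc, rfl⟩ := hO
    obtain ⟨d, hd, rfl⟩ := hO'
    rw [Finset.disjoint_left]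
    intro v hv hv'
    obtain ⟨x, rfl⟩ := hmem _ _ hv
    rw [htoF] at hv hv'
    exact hne (by rw [← hv, ← hv'])


structure Barrier {V : Type*} (H : SimpleGraph V) (W U : Finset V) (𝒪 : Finset (Finset V)) :
    Prop where
  sub : U ⊆ W
  osub : ∀ O ∈ 𝒪, O ⊆ W \ U
  odd : ∀ O ∈ 𝒪, Odd O.card
  cl : ∀ O ∈ 𝒪, ∀ x ∈ O, ∀ y ∈ W, H.Adj x y → y ∈ O ∨ y ∈ U
  dj : ∀ O ∈ 𝒪, ∀ O' ∈ 𝒪, O ≠ O' → Disjoint O O'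

lemma Barrier.uniq {V : Type*} {H : SimpleGraph V} {W U : Finset V} {𝒪 : Finset (Finset V)}
    (h : Barrier H W U 𝒪) {O O' : Finset V} (hO : O ∈ 𝒪) (hO' : O' ∈ 𝒪) {x : V} (hx : x ∈ O)
    (hx' : x ∈ O') : O = O' := by
  by_contra hne
  exact Finset.disjoint_left.1 (h.dj O hO O' hO' hne) hx hx'

lemma Barrier.count {V : Type*} {H : SimpleGraph V} {W U : Finset V} {𝒪 : Finset (Finset V)}
    (h : Barrier H W U 𝒪) (hc : U.card + 1 ≤ 𝒪.card) {v : V}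
    (hpm : PM H (W.erase v)) :
    𝒪.card = U.card + 1 ∧ (∀ O ∈ 𝒪, ∃ x ∈ O, PM H (O.erase x)) ∧
      PM H (W \ (U ∪ 𝒪.biUnion id)) := by
  obtain ⟨f, hf⟩ := hpm
  have hf1 : ∀ x ∈ W, x ≠ v → f x ∈ W ∧ f x ≠ v ∧ H.Adj x (f x) ∧ f (f x) = x := by
    intro x hx hxv
    have := hf x (by simp [hx, hxv])
    simp only [Finset.mem_erase] at this
    tauto
  have hOW : ∀ O ∈ 𝒪, ∀ x ∈ O, x ∈ W ∧ x ∉ U := fun O hO x hx => by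
    simpa using h.osub O hO hx
  have hex : ∀ O ∈ 𝒪, v ∉ O → ∃ x ∈ O, f x ∈ U := by
    intro O hO hv
    by_contra hcon
    push Not at hcon
    have : PM H O := by
      refine ⟨f, fun x hx => ?_⟩
      have hxv : x ≠ v := fun e => hv (e ▸ hx)
      have h1 := hf1 x (hOW O hO x hx).1 hxv
      refine ⟨?_, h1.2.2.1, h1.2.2.2⟩
      rcases h.cl O hO x hx _ h1.1 h1.2.2.1 with h2 | h2
      · exact h2
      · exact absurd h2 (hcon x hx)
    have := this.even
    rw [← Nat.not_odd_iff_even] at this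
    exact this (h.odd O hO)
  haveI : Nonempty V := ⟨v⟩
  choose! g hg1 hg2 using hex
  set P := 𝒪.filter (fun O => v ∉ O) with hP
  have hPc : 𝒪.card ≤ P.card + (𝒪.filter (fun O => v ∈ O)).card := by
    refine le_trans (Finset.card_le_card ?_) (Finset.card_union_le _ _)
    intro O hO
    simp only [hP, Finset.mem_union, Finset.mem_filter]
    tauto
  have hle1 : (𝒪.filter (fun O => v ∈ O)).card ≤ 1 := by
    rw [Finset.card_le_one]
    intro a ha b hb
    simp only [Finset.mem_filter] at ha hb
    exact h.uniq ha.1 hb.1 ha.2 hb.2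
  have hginj : Set.InjOn (fun O => f (g O)) (P : Set (Finset V)) := by
    intro O hO O' hO' heq
    simp only [hP, Finset.coe_filter, Set.mem_ofPred_eq] at hO hO'
    simp only at heq
    have e1 := hg1 O hO.1 hO.2
    have e2 := hg1 O' hO'.1 hO'.2
    have a1 := (hf1 _ (hOW O hO.1 _ e1).1 (fun e => hO.2 (e ▸ e1))).2.2.2
    have a2 := (hf1 _ (hOW O' hO'.1 _ e2).1 (fun e => hO'.2 (e ▸ e2))).2.2.2
    have : g O = g O' := by rw [← a1, heq, a2]
    exact h.uniq hO.1 hO'.1 e1 (this ▸ e2)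
  have hsub : P.image (fun O => f (g O)) ⊆ U.erase v := by
    intro y hy
    simp only [Finset.mem_image, hP, Finset.mem_filter] at hy
    obtain ⟨O, ⟨hO, hv⟩, rfl⟩ := hy
    have e1 := hg1 O hO hv
    have a1 := (hf1 _ (hOW O hO _ e1).1 (fun e => hv (e ▸ e1))).2.1
    simp [a1, hg2 O hO hv]
  have hPU : P.card ≤ (U.erase v).card := by
    rw [← Finset.card_image_of_injOn hginj]
    exact Finset.card_le_card hsub
  have hUe : (U.erase v).card ≤ U.card := Finset.card_le_card (Finset.erase_subset _ _)
  have hcard : 𝒪.card = U.card + 1 := by omega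
  have himg : P.image (fun O => f (g O)) = U := by
    apply Finset.eq_of_subset_of_card_le
    · exact hsub.trans (Finset.erase_subset _ _)
    · rw [Finset.card_image_of_injOn hginj]; omega
  have hvU : v ∉ U := by
    intro hv
    have := hsub (himg ▸ hv)
    simp at this
  have hv1 : ∃ O ∈ 𝒪, v ∈ O := by
    have : 0 < (𝒪.filter (fun O => v ∈ O)).card := by omega
    obtain ⟨O, hO⟩ := Finset.card_pos.1 this
    simp only [Finset.mem_filter] at hO
    exact ⟨O, hO⟩
  -- a vertex mapped into `U` is some `g O`
  have hback : ∀ y ∈ W, y ≠ v → f y ∈ U → ∃ O ∈ 𝒪, v ∉ O ∧ y = g O := by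
    intro y hy hyv hfy
    rw [← himg] at hfy
    simp only [Finset.mem_image, hP, Finset.mem_filter] at hfy
    obtain ⟨O, ⟨hO, hv⟩, he⟩ := hfy
    refine ⟨O, hO, hv, ?_⟩
    have e1 := hg1 O hO hv
    have a1 := (hf1 _ (hOW O hO _ e1).1 (fun e => hv (e ▸ e1))).2.2.2
    rw [← (hf1 y hy hyv).2.2.2, ← he, a1]
  refine ⟨hcard, ?_, ?_⟩
  · intro O hO
    by_cases hv : v ∈ O
    · refine ⟨v, hv, f, ?_⟩
      intro y hy
      simp only [Finset.mem_erase] at hy ⊢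
      have h1 := hf1 y (hOW O hO y hy.2).1 hy.1
      refine ⟨⟨h1.2.1, ?_⟩, h1.2.2⟩
      rcases h.cl O hO y hy.2 _ h1.1 h1.2.2.1 with h2 | h2
      · exact h2
      · obtain ⟨O', hO', hv', he⟩ := hback y (hOW O hO y hy.2).1 hy.1 h2
        have := h.uniq hO hO' hy.2 (he ▸ hg1 O' hO' hv')
        exact absurd (this ▸ hv) hv'
    · refine ⟨g O, hg1 O hO hv, f, ?_⟩
      intro y hy
      simp only [Finset.mem_erase] at hy ⊢
      have hyv : y ≠ v := fun e => hv (e ▸ hy.2)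
      have h1 := hf1 y (hOW O hO y hy.2).1 hyv
      have hfyU : f y ∉ U := by
        intro h2
        obtain ⟨O', hO', hv', he⟩ := hback y (hOW O hO y hy.2).1 hyv h2
        have := h.uniq hO hO' hy.2 (he ▸ hg1 O' hO' hv')
        subst this
        exact hy.1 he
      refine ⟨⟨?_, ?_⟩, h1.2.2⟩
      · intro e
        have h3 := hg2 O hO hv
        rw [← e, h1.2.2.2] at h3
        exact (hOW O hO y hy.2).2 h3
      · rcases h.cl O hO y hy.2 _ h1.1 h1.2.2.1 with h2 | h2
        · exact h2
        · exact absurd h2 hfyU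
  · refine ⟨f, ?_⟩
    intro y hy
    simp only [Finset.mem_sdiff, Finset.mem_union, Finset.mem_biUnion, id, not_or, not_exists,
      not_and] at hy ⊢
    obtain ⟨hyW, hyU, hyO⟩ := hy
    have hyv : y ≠ v := by
      rintro rfl
      obtain ⟨O, hO, hv⟩ := hv1
      exact hyO O hO hv
    have h1 := hf1 y hyW hyv
    refine ⟨⟨h1.1, ?_, ?_⟩, h1.2.2⟩
    · intro h2
      obtain ⟨O', hO', hv', he⟩ := hback y hyW hyv h2
      exact hyO O' hO' (he ▸ hg1 O' hO' hv')
    · intro O hO hfy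
      rcases h.cl O hO _ hfy y hyW h1.2.2.1.symm with h2 | h2
      · exact hyO O hO h2
      · exact hyU h2

/-- Barrier with factor-critical members. -/
structure GE {V : Type*} (H : SimpleGraph V) (W U : Finset V) (𝒪 : Finset (Finset V)) :
    Prop extends Barrier H W U 𝒪 where
  fc : ∀ O ∈ 𝒪, ∀ u ∈ O, PM H (O.erase u)

lemma exists_GE {V : Type*} (H : SimpleGraph V) : ∀ (n : ℕ) (W : Finset V), W.card = n →
    (∃ v ∈ W, PM H (W.erase v)) → ∃ U 𝒪, GE H W U 𝒪 ∧ U.card + 1 ≤ 𝒪.card := by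
  intro n
  induction n using Nat.strong_induction_on with
  | _ n ih =>
  intro W hWn hv
  have hodd : Odd W.card := by
    obtain ⟨v, hv, hpm⟩ := hv
    have := hpm.even
    rw [Finset.card_erase_of_mem hv] at this
    have hpos := Finset.card_pos.2 ⟨v, hv⟩
    have e : W.card = (W.card - 1) + 1 := by omega
    rw [e]
    exact this.add_one
  by_cases hall : ∀ u ∈ W, PM H (W.erase u)
  · refine ⟨∅, {W}, ⟨⟨by simp, by simp, by simpa using hodd, ?_, ?_⟩, by simpa using hall⟩, by simp⟩
    · intro O hO x hx y hy _
      simp only [Finset.mem_singleton] at hO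
      subst hO
      exact Or.inl hy
    · intro O hO O' hO' hne
      simp only [Finset.mem_singleton] at hO hO'
      exact absurd (hO.trans hO'.symm) hne
  push Not at hall
  obtain ⟨x, hx, hnpm⟩ := hall
  have hev : Even (W.erase x).card := by
    rw [Finset.card_erase_of_mem hx]
    obtain ⟨k, hk⟩ := hodd
    exact ⟨k, by omega⟩
  obtain ⟨U', hU', 𝒪, hcard, hO, hdj⟩ := tutte_fin H _ hev hnpm
  have hxU' : x ∉ U' := fun h => by simpa using hU' h
  have hB : Barrier H W (insert x U') 𝒪 := by
    refine ⟨?_, ?_, fun O h => (hO O h).2.1, ?_, hdj⟩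
    · intro y hy
      rcases Finset.mem_insert.1 hy with rfl | h
      · exact hx
      · exact Finset.mem_of_mem_erase (hU' h)
    · intro O h y hy
      have := (hO O h).1 hy
      simp only [Finset.mem_sdiff, Finset.mem_erase, Finset.mem_insert] at this ⊢
      tauto
    · intro O h y hy z hz hadj
      by_cases hzx : z = x
      · right; simp [hzx]
      · rcases (hO O h).2.2 y hy z (by simp [hz, hzx]) hadj with h1 | h1
        · exact Or.inl h1
        · right; simp [h1]
  have hUc : (insert x U').card = U'.card + 1 := Finset.card_insert_of_notMem hxU'
  set U := insert x U' with hU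
  obtain ⟨v, hvW, hpm⟩ := hv
  obtain ⟨-, hsub, -⟩ := hB.count (by omega) hpm
  have hrec : ∀ O ∈ 𝒪, ∃ P : Finset V × Finset (Finset V), GE H O P.1 P.2 ∧
      P.1.card + 1 ≤ P.2.card := by
    intro O hOm
    obtain ⟨y, hy, hpy⟩ := hsub O hOm
    have hlt : O.card < n := by
      rw [← hWn]
      apply Finset.card_lt_card
      rw [Finset.ssubset_iff_of_subset]
      · refine ⟨x, hx, fun h => ?_⟩
        have := hB.osub O hOm h
        simp [hU] at this
      · exact (hB.osub O hOm).trans Finset.sdiff_subset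
    obtain ⟨U1, 𝒪1, h1, h2⟩ := ih O.card hlt O rfl ⟨y, hy, hpy⟩
    exact ⟨(U1, 𝒪1), h1, h2⟩
  choose! P hP1 hP2 using hrec
  have hOW : ∀ O ∈ 𝒪, ∀ x ∈ O, x ∈ W ∧ x ∉ U := fun O hO x hx => by
    simpa using hB.osub O hO hx
  have hin : ∀ O ∈ 𝒪, ∀ Q ∈ (P O).2, ∀ y ∈ Q, y ∈ O ∧ y ∉ (P O).1 := fun O hO Q hQ y hy => by
    simpa using (hP1 O hO).osub Q hQ hy
  refine ⟨U ∪ 𝒪.biUnion (fun O => (P O).1), 𝒪.biUnion (fun O => (P O).2), ⟨⟨?_, ?_, ?_, ?_, ?_⟩, ?_⟩, ?_⟩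
  · apply Finset.union_subset hB.sub
    intro y hy
    simp only [Finset.mem_biUnion] at hy
    obtain ⟨O, hOm, hy⟩ := hy
    exact (hOW O hOm y ((hP1 O hOm).sub hy)).1
  · intro Q hQ y hy
    simp only [Finset.mem_biUnion] at hQ
    obtain ⟨O, hOm, hQ⟩ := hQ
    have h1 := hin O hOm Q hQ y hy
    have h2 := hOW O hOm y h1.1
    simp only [Finset.mem_sdiff, Finset.mem_union, Finset.mem_biUnion, not_or, not_exists, not_and]
    refine ⟨h2.1, h2.2, fun O' hO' h3 => ?_⟩
    have := hB.uniq hOm hO' h1.1 ((hP1 O' hO').sub h3)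
    subst this
    exact h1.2 h3
  · intro Q hQ
    simp only [Finset.mem_biUnion] at hQ
    obtain ⟨O, hOm, hQ⟩ := hQ
    exact (hP1 O hOm).odd Q hQ
  · intro Q hQ y hy z hz hadj
    simp only [Finset.mem_biUnion] at hQ
    obtain ⟨O, hOm, hQ⟩ := hQ
    have h1 := hin O hOm Q hQ y hy
    simp only [Finset.mem_union, Finset.mem_biUnion]
    rcases hB.cl O hOm y h1.1 z hz hadj with h2 | h2
    · rcases (hP1 O hOm).cl Q hQ y hy z h2 hadj with h3 | h3
      · exact Or.inl h3
      · exact Or.inr (Or.inr ⟨O, hOm, h3⟩)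
    · exact Or.inr (Or.inl h2)
  · intro Q hQ Q' hQ' hne
    simp only [Finset.mem_biUnion] at hQ hQ'
    obtain ⟨O, hOm, hQ⟩ := hQ
    obtain ⟨O', hOm', hQ'⟩ := hQ'
    rw [Finset.disjoint_left]
    intro y hy hy'
    have h1 := hin O hOm Q hQ y hy
    have h2 := hin O' hOm' Q' hQ' y hy'
    have := hB.uniq hOm hOm' h1.1 h2.1
    subst this
    exact hne ((hP1 O hOm).toBarrier.uniq hQ hQ' hy hy')
  · intro Q hQ
    simp only [Finset.mem_biUnion] at hQ
    obtain ⟨O, hOm, hQ⟩ := hQ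
    exact (hP1 O hOm).fc Q hQ
  · have e1 : (𝒪.biUnion (fun O => (P O).2)).card = ∑ O ∈ 𝒪, (P O).2.card := by
      apply Finset.card_biUnion
      intro O hOm O' hOm' hne
      refine Finset.disjoint_left.2 ?_
      intro Q hQ hQ'
      have hne2 : Q.Nonempty := Finset.card_pos.1 ((hP1 O hOm).odd Q hQ).pos
      obtain ⟨y, hy⟩ := hne2
      exact hne (hB.uniq hOm hOm' (hin O hOm Q hQ y hy).1 (hin O' hOm' Q hQ' y hy).1)
    have e2 := Finset.card_union_le U (𝒪.biUnion (fun O => (P O).1))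
    have e3 := Finset.card_biUnion_le (s := 𝒪) (t := fun O => (P O).1)
    have e4 : ∑ O ∈ 𝒪, ((P O).1.card + 1) ≤ ∑ O ∈ 𝒪, (P O).2.card :=
      Finset.sum_le_sum (fun O hOm => hP2 O hOm)
    rw [Finset.sum_add_distrib, Finset.sum_const, smul_eq_mul, mul_one] at e4
    omega

lemma exists_GE' {V : Type*} (H : SimpleGraph V) (W : Finset V) {v : V} (hvW : v ∈ W)
    (hpm : PM H (W.erase v)) : ∃ U 𝒪, GE H W U 𝒪 ∧ U.card + 1 ≤ 𝒪.card ∧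
      ∀ O ∈ 𝒪, ∀ u ∈ O, PM H (W.erase u) := by
  have hex : ∃ n, ∃ U 𝒪, GE H W U 𝒪 ∧ U.card + 1 ≤ 𝒪.card ∧ U.card = n := by
    obtain ⟨U, 𝒪, h1, h2⟩ := exists_GE H _ W rfl ⟨v, hvW, hpm⟩
    exact ⟨_, U, 𝒪, h1, h2, rfl⟩
  obtain ⟨U, 𝒪, hGE, hc, hn⟩ := Nat.find_spec hex
  have hmin := fun m => Nat.find_min hex (m := m)
  rw [← hn] at hmin
  refine ⟨U, 𝒪, hGE, hc, ?_⟩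
  intro O₀ hO₀ u hu
  have hB := hGE.toBarrier
  obtain ⟨hcard, -, hrest⟩ := hB.count hc hpm
  have hOW : ∀ O ∈ 𝒪, ∀ x ∈ O, x ∈ W ∧ x ∉ U := fun O hO x hx => by
    simpa using hB.osub O hO hx
  let t : U → Finset (Finset V) := fun w => (𝒪.erase O₀).filter (fun O => ∃ x ∈ O, H.Adj w x)
  have hall : ∀ s : Finset U, s.card ≤ (s.biUnion t).card := by
    intro s
    by_contra hlt
    push Not at hlt
    let U' : Finset V := s.image Subtype.val
    have hU'c : U'.card = s.card := Finset.card_image_of_injective _ Subtype.val_injective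
    have hU'U : U' ⊆ U := by
      intro y hy
      simp only [U', Finset.mem_image] at hy
      obtain ⟨z, _, rfl⟩ := hy
      exact z.2
    let N' := 𝒪.filter (fun O => ∃ w ∈ U', ∃ x ∈ O, H.Adj w x)
    have hN' : N' ⊆ insert O₀ (s.biUnion t) := by
      intro O hO
      simp only [N', Finset.mem_filter] at hO
      obtain ⟨hO, w, hw, hx⟩ := hO
      simp only [U', Finset.mem_image] at hw
      obtain ⟨w, hw, rfl⟩ := hw
      simp only [Finset.mem_insert, Finset.mem_biUnion, t, Finset.mem_filter, Finset.mem_erase]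
      by_cases e : O = O₀
      · exact Or.inl e
      · exact Or.inr ⟨w, hw, ⟨e, hO⟩, hx⟩
    have hN'c : N'.card ≤ s.card :=
      (Finset.card_le_card hN').trans ((Finset.card_insert_le _ _).trans (by omega))
    have hsd : (𝒪 \ N').card = 𝒪.card - N'.card :=
      Finset.card_sdiff_of_subset (Finset.filter_subset _ _)
    have hsd2 : (U \ U').card = U.card - U'.card := Finset.card_sdiff_of_subset hU'U
    have hle := Finset.card_le_card hU'U
    refine hmin (U \ U').card (by omega) ⟨U \ U', 𝒪 \ N', ⟨⟨?_, ?_, ?_, ?_, ?_⟩, ?_⟩, by omega, rfl⟩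
    · exact Finset.sdiff_subset.trans hB.sub
    · intro O hO y hy
      have := hOW O (Finset.mem_sdiff.1 hO).1 y hy
      simp only [Finset.mem_sdiff]
      tauto
    · exact fun O hO => hB.odd O (Finset.mem_sdiff.1 hO).1
    · intro O hO x hx y hy hadj
      have hO1 := Finset.mem_sdiff.1 hO
      rcases hB.cl O hO1.1 x hx y hy hadj with h | h
      · exact Or.inl h
      · right
        simp only [Finset.mem_sdiff]
        refine ⟨h, fun hyU' => hO1.2 ?_⟩
        simp only [N', Finset.mem_filter]
        exact ⟨hO1.1, y, hyU', x, hx, hadj.symm⟩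
    · exact fun O hO O' hO' => hB.dj O (Finset.mem_sdiff.1 hO).1 O' (Finset.mem_sdiff.1 hO').1
    · exact fun O hO => hGE.fc O (Finset.mem_sdiff.1 hO).1
  obtain ⟨g, hginj, hgt⟩ := (Finset.all_card_le_biUnion_card_iff_exists_injective t).1 hall
  have hg1 : ∀ w, g w ∈ 𝒪 ∧ g w ≠ O₀ ∧ ∃ x ∈ g w, H.Adj w x := by
    intro w
    have := hgt w
    simp only [t, Finset.mem_filter, Finset.mem_erase] at this
    tauto
  have himg : Finset.univ.image g = 𝒪.erase O₀ := by
    apply Finset.eq_of_subset_of_card_le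
    · intro O hO
      simp only [Finset.mem_image, Finset.mem_univ, true_and] at hO
      obtain ⟨w, rfl⟩ := hO
      simp [hg1 w]
    · rw [Finset.card_image_of_injective _ hginj, Finset.card_erase_of_mem hO₀]
      simp only [Finset.card_univ, Fintype.card_coe]
      omega
  have hset : W.erase u = (O₀.erase u ∪ Finset.univ.biUnion (fun w : U => insert w.1 (g w))) ∪
      W \ (U ∪ 𝒪.biUnion id) := by
    ext y
    simp only [Finset.mem_erase, Finset.mem_union, Finset.mem_biUnion, Finset.mem_univ, true_and,
      Finset.mem_insert, Finset.mem_sdiff, id, not_or, not_exists, not_and]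
    constructor
    · rintro ⟨hyu, hyW⟩
      by_cases hyU : y ∈ U
      · left; right; exact ⟨⟨y, hyU⟩, Or.inl rfl⟩
      by_cases hyO : ∃ O ∈ 𝒪, y ∈ O
      · obtain ⟨O, hO, hy⟩ := hyO
        left
        by_cases e : O = O₀
        · subst e; left; exact ⟨hyu, hy⟩
        · right
          have : O ∈ Finset.univ.image g := by rw [himg]; simp [e, hO]
          simp only [Finset.mem_image, Finset.mem_univ, true_and] at this
          obtain ⟨w, rfl⟩ := this
          exact ⟨w, Or.inr hy⟩
      · push Not at hyO
        right; exact ⟨hyW, hyU, hyO⟩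
    · rintro ((⟨h1, h2⟩ | ⟨w, h1 | h1⟩) | ⟨h1, h2, h3⟩)
      · exact ⟨h1, (hOW O₀ hO₀ y h2).1⟩
      · refine ⟨?_, ?_⟩
        · rintro rfl
          exact (hOW O₀ hO₀ _ hu).2 (h1 ▸ w.2)
        · rw [h1]; exact hB.sub w.2
      · refine ⟨?_, (hOW _ (hg1 w).1 y h1).1⟩
        rintro rfl
        exact (hg1 w).2.1 (hB.uniq (hg1 w).1 hO₀ h1 hu)
      · refine ⟨?_, h1⟩
        rintro rfl
        exact h3 O₀ hO₀ hu
  rw [hset]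
  refine PM.union (PM.union (hGE.fc O₀ hO₀ u hu) (PM.biUnion _ _ ?_ ?_) ?_) hrest ?_
  · intro w _
    obtain ⟨x, hx, hadj⟩ := (hg1 w).2.2
    have : insert w.1 (g w) = {w.1, x} ∪ (g w).erase x := by
      ext y
      simp only [Finset.mem_insert, Finset.mem_union, Finset.mem_singleton, Finset.mem_erase]
      by_cases e : y = x
      · subst e; simp [hx]
      · simp [e]
    rw [this]
    refine PM.union (PM.pair hadj) (hGE.fc _ (hg1 w).1 x hx) ?_
    rw [Finset.disjoint_left]
    intro y hy
    simp only [Finset.mem_insert, Finset.mem_singleton] at hy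
    rcases hy with rfl | rfl
    · intro h
      exact (hOW _ (hg1 w).1 _ (Finset.mem_of_mem_erase h)).2 w.2
    · simp
  · intro w _ w' _ hne
    rw [Finset.disjoint_left]
    intro y hy hy'
    simp only [Finset.mem_insert] at hy hy'
    rcases hy with rfl | hy <;> rcases hy' with h | hy'
    · exact hne (Subtype.ext h)
    · exact (hOW _ (hg1 w').1 _ hy').2 w.2
    · rw [h] at hy
      exact (hOW _ (hg1 w).1 _ hy).2 w'.2
    · exact hne (hginj (hB.uniq (hg1 w).1 (hg1 w').1 hy hy'))
  · rw [Finset.disjoint_left]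
    intro y hy hy'
    simp only [Finset.mem_biUnion, Finset.mem_univ, true_and, Finset.mem_insert] at hy'
    obtain ⟨w, rfl | h⟩ := hy'
    · exact (hOW _ hO₀ _ (Finset.mem_of_mem_erase hy)).2 w.2
    · exact (hg1 w).2.1 (hB.uniq (hg1 w).1 hO₀ h (Finset.mem_of_mem_erase hy))
  · rw [Finset.disjoint_left]
    intro y hy hy'
    simp only [Finset.mem_biUnion, Finset.mem_univ, true_and, Finset.mem_insert, Finset.mem_union,
      Finset.mem_sdiff, id, not_or, not_exists, not_and] at hy hy'
    obtain ⟨h1, h2, h3⟩ := hy'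
    rcases hy with h | ⟨w, rfl | h⟩
    · exact h3 O₀ hO₀ (Finset.mem_of_mem_erase h)
    · exact h2 w.2
    · exact h3 _ (hg1 w).1 h


/-- Neighbours of `x` inside `S`. -/
noncomputable def nb {V : Type*} (H : SimpleGraph V) (S : Finset V) (x : V) : Finset V :=
  S.filter (fun y => H.Adj x y)

lemma mem_nb {V : Type*} {H : SimpleGraph V} {S : Finset V} {x y : V} :
    y ∈ nb H S x ↔ y ∈ S ∧ H.Adj x y := by simp [nb]

lemma exists_good_vertex {V : Type*} (H : SimpleGraph V) (W : Finset V) {v : V} (hvW : v ∈ W)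
    (hpm : PM H (W.erase v)) : ∃ Q ⊆ W, (∀ u ∈ Q, PM H (W.erase u)) ∧
      ((∃ u ∈ Q, nb H W u = ∅) ∨
        ∃ w ∈ W, ∃ u ∈ Q, H.Adj w u ∧ (nb H W u).card ≤ (nb H Q w).card) := by
  obtain ⟨U, 𝒪, hGE, hc, hD⟩ := exists_GE' H W hvW hpm
  have hB := hGE.toBarrier
  have hOW : ∀ O ∈ 𝒪, ∀ x ∈ O, x ∈ W ∧ x ∉ U := fun O hO x hx => by
    simpa using hB.osub O hO hx
  set Q := 𝒪.biUnion id with hQ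
  have hmQ : ∀ x, x ∈ Q ↔ ∃ O ∈ 𝒪, x ∈ O := by intro x; simp [hQ]
  have hQW : Q ⊆ W := by
    intro x hx
    obtain ⟨O, hO, hx⟩ := (hmQ x).1 hx
    exact (hOW O hO x hx).1
  refine ⟨Q, hQW, ?_, ?_⟩
  · intro u hu
    obtain ⟨O, hO, hu⟩ := (hmQ u).1 hu
    exact hD O hO u hu
  by_contra hcon
  push Not at hcon
  obtain ⟨hcon1, hcon2⟩ := hcon
  -- the weight of a vertex
  let s : V → ℚ := fun u => ∑ w ∈ nb H U u, 1 / ((nb H Q w).card : ℚ)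
  have hs0 : ∀ u, 0 ≤ s u := fun u => Finset.sum_nonneg (fun w _ => by positivity)
  have hup : ∑ w ∈ U, ∑ _u ∈ nb H Q w, 1 / ((nb H Q w).card : ℚ) ≤ (U.card : ℚ) := by
    have : ∀ w ∈ U, ∑ _u ∈ nb H Q w, 1 / ((nb H Q w).card : ℚ) ≤ 1 := by
      intro w _
      rw [Finset.sum_const, nsmul_eq_mul, mul_one_div]
      exact div_self_le_one _
    refine (Finset.sum_le_sum this).trans ?_
    simp
  have hswap : ∑ w ∈ U, ∑ _u ∈ nb H Q w, 1 / ((nb H Q w).card : ℚ) = ∑ u ∈ Q, s u := by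
    apply Finset.sum_comm'
    intro x y
    simp only [mem_nb]
    constructor
    · rintro ⟨a, b, c⟩; exact ⟨⟨a, c.symm⟩, b⟩
    · rintro ⟨⟨a, b⟩, c⟩; exact ⟨a, c, b.symm⟩
  have hsplit : ∑ u ∈ Q, s u = ∑ O ∈ 𝒪, ∑ u ∈ O, s u := by
    rw [hQ, Finset.sum_biUnion]
    · simp
    · intro O hO O' hO' hne
      exact hB.dj O hO O' hO' hne
  have hdeg : ∀ O ∈ 𝒪, ∀ u ∈ O, (nb H W u).card = (nb H O u).card + (nb H U u).card := by
    intro O hO u hu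
    rw [← Finset.card_union_of_disjoint]
    · congr 1
      ext y
      simp only [mem_nb, Finset.mem_union]
      constructor
      · rintro ⟨a, b⟩
        rcases hB.cl O hO u hu y a b with h | h
        · exact Or.inl ⟨h, b⟩
        · exact Or.inr ⟨h, b⟩
      · rintro (⟨a, b⟩ | ⟨a, b⟩)
        · exact ⟨(hOW O hO y a).1, b⟩
        · exact ⟨hB.sub a, b⟩
    · rw [Finset.disjoint_left]
      intro y hy hy'
      rw [mem_nb] at hy hy'
      exact (hOW O hO y hy.1).2 hy'.1
  have hfO : ∀ O ∈ 𝒪, ∀ w ∈ O, nb H Q w = nb H O w := by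
    intro O hO w hw
    ext y
    simp only [mem_nb]
    constructor
    · rintro ⟨a, b⟩
      refine ⟨?_, b⟩
      obtain ⟨O', hO', hy⟩ := (hmQ y).1 a
      rcases hB.cl O hO w hw y (hOW O' hO' y hy).1 b with h | h
      · exact h
      · exact absurd h (hOW O' hO' y hy).2
    · rintro ⟨a, b⟩
      exact ⟨(hmQ y).2 ⟨O, hO, a⟩, b⟩
  have hlow : ∀ O ∈ 𝒪, ∀ u ∈ O, ∀ m : ℕ, 1 ≤ m →
      (nb H O u).card + (nb H U u).card ≤ m + 1 → 
      ((nb H U u).card : ℚ) / m ≤ s u := by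
    intro O hO u hu m hm1 hm
    have hterm : ∀ w ∈ nb H U u, (1 : ℚ) / m ≤ 1 / ((nb H Q w).card : ℚ) := by
      intro w hw
      rw [mem_nb] at hw
      have huQ : u ∈ Q := (hmQ u).2 ⟨O, hO, hu⟩
      have h1 := hcon2 w (hB.sub hw.1) u huQ hw.2.symm
      rw [hdeg O hO u hu] at h1
      have h2 : 0 < (nb H Q w).card := Finset.card_pos.2 ⟨u, mem_nb.2 ⟨huQ, hw.2.symm⟩⟩
      apply one_div_le_one_div_of_le
      · exact_mod_cast h2
      · exact_mod_cast (by omega : (nb H Q w).card ≤ m)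
    have := Finset.sum_le_sum hterm
    rw [Finset.sum_const, nsmul_eq_mul, mul_one_div] at this
    exact this
  have hone : ∀ O ∈ 𝒪, (1 : ℚ) ≤ ∑ u ∈ O, s u := by
    intro O hO
    have hne : O.Nonempty := Finset.card_pos.1 (hB.odd O hO).pos
    obtain ⟨w, hw, hmax⟩ := Finset.exists_max_image O (fun x => (nb H O x).card) hne
    have hwQ : w ∈ Q := (hmQ w).2 ⟨O, hO, hw⟩
    rcases Nat.eq_zero_or_pos (nb H O w).card with h0 | hpos
    · have h1 : 1 ≤ (nb H W w).card := by
        have := hcon1 w hwQ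
        exact Finset.card_pos.2 (by simpa [Finset.nonempty_iff_ne_empty] using this)
      rw [hdeg O hO w hw, h0, zero_add] at h1
      have h2 := hlow O hO w hw (nb H U w).card h1 (by omega)
      rw [div_self (by positivity)] at h2
      exact h2.trans (Finset.single_le_sum (fun u _ => hs0 u) hw)
    · set Δ := (nb H O w).card with hΔ
      have hsub : nb H O w ⊆ O := Finset.filter_subset _ _
      have hterm : ∀ u ∈ nb H O w, (1 : ℚ) / Δ ≤ s u := by
        intro u hu
        rw [mem_nb] at hu
        have huQ : u ∈ Q := (hmQ u).2 ⟨O, hO, hu.1⟩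
        have h1 := hcon2 w (hQW hwQ) u huQ hu.2
        rw [hdeg O hO u hu.1, hfO O hO w hw, ← hΔ] at h1
        have h2 := hmax u hu.1
        obtain ⟨g, hg⟩ : ∃ g, (nb H U u).card = g + 1 :=
          Nat.exists_eq_succ_of_ne_zero (by omega)
        have h3 := hlow O hO u hu.1 (Δ + g) (by omega) (by omega)
        refine le_trans ?_ h3
        have hΔ' : (1 : ℚ) ≤ (Δ : ℚ) := by exact_mod_cast hpos
        rw [hg]
        push_cast
        rw [div_le_div_iff₀ (by linarith) (by positivity)]
        have : (0 : ℚ) ≤ g * (Δ - 1) := mul_nonneg (by positivity) (by linarith)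
        nlinarith
      have h4 := Finset.sum_le_sum hterm
      rw [Finset.sum_const, nsmul_eq_mul, mul_one_div, ← hΔ, div_self (by positivity)] at h4
      exact h4.trans (Finset.sum_le_sum_of_subset_of_nonneg hsub (fun u _ _ => hs0 u))
  have hfin := Finset.sum_le_sum hone
  rw [← hsplit, ← hswap] at hfin
  have h5 := hfin.trans hup
  rw [Finset.sum_const, nsmul_eq_mul, mul_one] at h5
  have : 𝒪.card ≤ U.card := by exact_mod_cast h5
  omega


/-- `Cfg H S t d`: `S` can be partitioned into `t` triangles, `d` singletons and some edges. -/
inductive Cfg {V : Type*} (H : SimpleGraph V) : Finset V → ℕ → ℕ → Prop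
  | empty : Cfg H ∅ 0 0
  | tri {S t d x y z} : Cfg H S t d → x ∉ S → y ∉ S → z ∉ S → H.Adj x y → H.Adj x z →
      H.Adj y z → Cfg H (insert x (insert y (insert z S))) (t + 1) d
  | single {S t d x} : Cfg H S t d → x ∉ S → Cfg H (insert x S) t (d + 1)
  | edge {S t d x y} : Cfg H S t d → x ∉ S → y ∉ S → H.Adj x y →
      Cfg H (insert x (insert y S)) t d

lemma Cfg.colour {V : Type*} {H : SimpleGraph V} {S : Finset V} {t d : ℕ} (h : Cfg H S t d) :
    ∃ m, 2 * m + t = S.card + d ∧ ∃ c : V → ℕ, (∀ x ∈ S, c x < m) ∧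
      ∀ x ∈ S, ∀ y ∈ S, x ≠ y → c x = c y → H.Adj x y := by
  induction h with
  | empty => exact ⟨0, by simp, fun _ => 0, by simp, by simp⟩
  | @tri S t d x y z _ hx hy hz hxy hxz hyz ih =>
    obtain ⟨m, hm, c, hc1, hc2⟩ := ih
    have n1 := hxy.ne
    have n2 := hxz.ne
    have n3 := hyz.ne
    refine ⟨m + 1, ?_, fun v => if v ∈ S then c v else m, ?_, ?_⟩
    · rw [Finset.card_insert_of_notMem (by simp [n1, n2, hx]),
        Finset.card_insert_of_notMem (by simp [n3, hy]), Finset.card_insert_of_notMem hz]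
      omega
    · intro v hv
      by_cases h : v ∈ S
      · simp only [h, if_true]; have := hc1 v h; omega
      · simp [h]
    · intro u hu v hv huv
      simp only [Finset.mem_insert] at hu hv
      have := hxy.symm
      have := hxz.symm
      have := hyz.symm
      grind
  | @single S t d x _ hx ih =>
    obtain ⟨m, hm, c, hc1, hc2⟩ := ih
    refine ⟨m + 1, ?_, fun v => if v ∈ S then c v else m, ?_, ?_⟩
    · rw [Finset.card_insert_of_notMem hx]
      omega
    · intro v hv
      by_cases h : v ∈ S
      · simp only [h, if_true]; have := hc1 v h; omega
      · simp [h]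
    · intro u hu v hv huv
      simp only [Finset.mem_insert] at hu hv
      grind
  | @edge S t d x y _ hx hy hxy ih =>
    obtain ⟨m, hm, c, hc1, hc2⟩ := ih
    have n1 := hxy.ne
    refine ⟨m + 1, ?_, fun v => if v ∈ S then c v else m, ?_, ?_⟩
    · rw [Finset.card_insert_of_notMem (by simp [n1, hx]),
        Finset.card_insert_of_notMem hy]
      omega
    · intro v hv
      by_cases h : v ∈ S
      · simp only [h, if_true]; have := hc1 v h; omega
      · simp [h]
    · intro u hu v hv huv
      simp only [Finset.mem_insert] at hu hv
      have := hxy.symm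
      grind

lemma Cfg.addPM {V : Type*} {H : SimpleGraph V} {S : Finset V} {t d : ℕ} (h : Cfg H S t d) :
    ∀ (n : ℕ) (X : Finset V), X.card = n → PM H X → Disjoint S X → Cfg H (S ∪ X) t d := by
  intro n
  induction n using Nat.strong_induction_on with
  | _ n ih =>
  intro X hn hX hd
  rcases X.eq_empty_or_nonempty with rfl | ⟨x, hx⟩
  · simpa using h
  obtain ⟨f, hf⟩ := hX
  have h1 := hf x hx
  have hne := h1.2.1.ne
  have hpm : PM H (X \ {x, f x}) := by
    refine ⟨f, fun y hy => ?_⟩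
    simp only [Finset.mem_sdiff, Finset.mem_insert, Finset.mem_singleton, not_or] at hy ⊢
    have := hf y hy.1
    grind
  have hlt : (X \ {x, f x}).card < n := by
    rw [← hn]
    apply Finset.card_lt_card
    rw [Finset.ssubset_iff_of_subset Finset.sdiff_subset]
    exact ⟨x, hx, by simp⟩
  have h2 := ih _ hlt _ rfl hpm (hd.mono_right Finset.sdiff_subset)
  have hxS : x ∉ S := fun e => Finset.disjoint_left.1 hd e hx
  have hfxS : f x ∉ S := fun e => Finset.disjoint_left.1 hd e h1.1
  have h3 := h2.edge (x := x) (y := f x) (by simp [hxS]) (by simp [hfxS]) h1.2.1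
  convert h3 using 1
  ext y
  simp only [Finset.mem_union, Finset.mem_insert, Finset.mem_sdiff, Finset.mem_singleton]
  grind

lemma Cfg.addR {V : Type*} {H : SimpleGraph V} {S : Finset V} {t d : ℕ} (h : Cfg H S t d)
    (R : Finset V) (hd : Disjoint S R) : Cfg H (S ∪ R) t (d + R.card) := by
  induction R using Finset.induction_on with
  | empty => simpa using h
  | insert a R ha ih =>
    rw [Finset.disjoint_insert_right] at hd
    have := (ih hd.2).single (x := a) (by simp [hd.1, ha])
    rw [Finset.card_insert_of_notMem ha, Finset.union_insert]
    exact this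

lemma Cfg.addT {V : Type*} {H : SimpleGraph V} {S : Finset V} {t d : ℕ} (h : Cfg H S t d)
    (𝒯 : Finset (Finset V)) (htri : ∀ T ∈ 𝒯, H.IsNClique 3 T)
    (hdj : ∀ T ∈ 𝒯, ∀ T' ∈ 𝒯, T ≠ T' → Disjoint T T')
    (hd : ∀ T ∈ 𝒯, Disjoint S T) : Cfg H (S ∪ 𝒯.biUnion id) (t + 𝒯.card) d := by
  induction 𝒯 using Finset.induction_on with
  | empty => simpa using h
  | insert T 𝒯 ha ih =>
    have h1 := ih (fun T' hT' => htri T' (by simp [hT']))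
      (fun T' hT' T'' hT'' => hdj T' (by simp [hT']) T'' (by simp [hT'']))
      (fun T' hT' => hd T' (by simp [hT']))
    have h2 : Disjoint (S ∪ 𝒯.biUnion id) T := by
      rw [Finset.disjoint_union_left, Finset.disjoint_biUnion_left]
      refine ⟨hd T (by simp), fun T' hT' => ?_⟩
      exact hdj T' (by simp [hT']) T (by simp) (fun e => ha (e ▸ hT'))
    have h3 := htri T (by simp)
    rw [is3Clique_iff] at h3
    obtain ⟨a, b, c, hab, hac, hbc, rfl⟩ := h3
    have h4 := h1.tri (fun e => Finset.disjoint_left.1 h2 e (by simp))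
      (fun e => Finset.disjoint_left.1 h2 e (by simp))
      (fun e => Finset.disjoint_left.1 h2 e (by simp)) hab hac hbc
    rw [Finset.card_insert_of_notMem ha]
    rw [← add_assoc]
    convert h4 using 1
    ext y
    simp only [Finset.mem_union, Finset.mem_insert, Finset.mem_singleton, Finset.biUnion_insert, id]
    tauto

/-- An explicit configuration. -/
structure Conf {V : Type*} (H : SimpleGraph V) (S : Finset V) (𝒯 : Finset (Finset V))
    (R X : Finset V) : Prop where
  tri : ∀ T ∈ 𝒯, H.IsNClique 3 T
  dj : ∀ T ∈ 𝒯, ∀ T' ∈ 𝒯, T ≠ T' → Disjoint T T'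
  dR : ∀ T ∈ 𝒯, Disjoint T R
  dX : ∀ T ∈ 𝒯, Disjoint T X
  dRX : Disjoint R X
  pm : PM H X
  un : ∀ x, x ∈ S ↔ (∃ T ∈ 𝒯, x ∈ T) ∨ x ∈ R ∨ x ∈ X

/-- The base part of a configuration, with all disjointness conditions. -/
lemma Conf.cfg {V : Type*} {H : SimpleGraph V} {S : Finset V} {𝒯 : Finset (Finset V)}
    {R X : Finset V} (h : Conf H S 𝒯 R X) : Cfg H S 𝒯.card R.card := by
  have h1 := ((Cfg.empty (H := H)).addPM _ X rfl h.pm (by simp)).addR R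
    (by simpa using h.dRX.symm)
  have h2 := h1.addT 𝒯 h.tri h.dj (by
    intro T hT
    rw [Finset.disjoint_union_left]
    simp only [Finset.empty_union]
    exact ⟨(h.dX T hT).symm, (h.dR T hT).symm⟩)
  convert h2 using 1
  · ext x
    rw [h.un]
    simp only [Finset.mem_union, Finset.mem_biUnion, id, Finset.notMem_empty, false_or]
    generalize (∃ T ∈ 𝒯, x ∈ T) = P
    tauto
  · simp
  · simp

lemma Cfg.conf {V : Type*} {H : SimpleGraph V} {S : Finset V} {t d : ℕ} (h : Cfg H S t d) :
    ∃ 𝒯 R X, Conf H S 𝒯 R X ∧ 𝒯.card = t ∧ R.card = d := by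
  induction h with
  | empty => exact ⟨∅, ∅, ∅, ⟨by simp, by simp, by simp, by simp, by simp, PM.empty H, by simp⟩,
      rfl, rfl⟩
  | @tri S t d x y z _ hx hy hz hxy hxz hyz ih =>
    obtain ⟨𝒯, R, X, hc, h1, h2⟩ := ih
    have key : ∀ v ∈ ({x, y, z} : Finset V), v ∉ S := by
      intro v hv
      simp only [Finset.mem_insert, Finset.mem_singleton] at hv
      rcases hv with rfl | rfl | rfl <;> assumption
    have hTS : ∀ T ∈ 𝒯, ∀ v ∈ T, v ∈ S := fun T hT v hv => (hc.un v).2 (Or.inl ⟨T, hT, hv⟩)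
    have hdd : ∀ T ∈ 𝒯, Disjoint T {x, y, z} := fun T hT =>
      Finset.disjoint_left.2 (fun v hv hv' => key v hv' (hTS T hT v hv))
    have hnew : ({x, y, z} : Finset V) ∉ 𝒯 := fun e => hx (hTS _ e x (by simp))
    refine ⟨insert {x, y, z} 𝒯, R, X, ⟨?_, ?_, ?_, ?_, hc.dRX, hc.pm, ?_⟩, ?_, h2⟩
    · intro T hT
      rcases Finset.mem_insert.1 hT with rfl | hT
      · rw [is3Clique_iff]; exact ⟨x, y, z, hxy, hxz, hyz, rfl⟩
      · exact hc.tri T hT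
    · intro T hT T' hT' hne
      rcases Finset.mem_insert.1 hT with rfl | hT <;> rcases Finset.mem_insert.1 hT' with rfl | hT'
      · exact absurd rfl hne
      · exact (hdd T' hT').symm
      · exact hdd T hT
      · exact hc.dj T hT T' hT' hne
    · intro T hT
      rcases Finset.mem_insert.1 hT with rfl | hT
      · exact Finset.disjoint_left.2 (fun v hv hv' => key v hv ((hc.un v).2 (by tauto)))
      · exact hc.dR T hT
    · intro T hT
      rcases Finset.mem_insert.1 hT with rfl | hT
      · exact Finset.disjoint_left.2 (fun v hv hv' => key v hv ((hc.un v).2 (by tauto)))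
      · exact hc.dX T hT
    · intro v
      rw [Finset.exists_mem_insert]
      simp only [Finset.mem_insert, hc.un v, Finset.mem_singleton]
      generalize (∃ T ∈ 𝒯, v ∈ T) = P
      tauto
    · rw [Finset.card_insert_of_notMem hnew, h1]
  | @single S t d x _ hx ih =>
    obtain ⟨𝒯, R, X, hc, h1, h2⟩ := ih
    have hx' := hx
    rw [hc.un] at hx'
    push Not at hx'
    refine ⟨𝒯, insert x R, X, ⟨hc.tri, hc.dj, ?_, hc.dX, ?_, hc.pm, ?_⟩, h1, ?_⟩
    · intro T hT
      rw [Finset.disjoint_insert_right]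
      exact ⟨hx'.1 T hT, hc.dR T hT⟩
    · rw [Finset.disjoint_insert_left]
      exact ⟨hx'.2.2, hc.dRX⟩
    · intro v
      simp only [Finset.mem_insert, hc.un v]
      generalize (∃ T ∈ 𝒯, v ∈ T) = P
      tauto
    · rw [Finset.card_insert_of_notMem hx'.2.1, h2]
  | @edge S t d x y _ hx hy hxy ih =>
    obtain ⟨𝒯, R, X, hc, h1, h2⟩ := ih
    have hx' := hx
    rw [hc.un] at hx'
    have hy' := hy
    rw [hc.un] at hy'
    push Not at hx' hy'
    refine ⟨𝒯, R, {x, y} ∪ X, ⟨hc.tri, hc.dj, hc.dR, ?_, ?_, ?_, ?_⟩, h1, h2⟩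
    · intro T hT
      rw [Finset.disjoint_union_right, Finset.disjoint_insert_right, Finset.disjoint_singleton_right]
      exact ⟨⟨hx'.1 T hT, hy'.1 T hT⟩, hc.dX T hT⟩
    · rw [Finset.disjoint_union_right, Finset.disjoint_insert_right, Finset.disjoint_singleton_right]
      exact ⟨⟨hx'.2.1, hy'.2.1⟩, hc.dRX⟩
    · refine PM.union (PM.pair hxy) hc.pm ?_
      rw [Finset.disjoint_insert_left, Finset.disjoint_singleton_left]
      exact ⟨hx'.2.2, hy'.2.2⟩
    · intro v
      simp only [Finset.mem_insert, hc.un v, Finset.mem_union, Finset.mem_singleton]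
      generalize (∃ T ∈ 𝒯, v ∈ T) = P
      tauto


/-- Optimality of the parameters of a configuration on `S`. -/
structure Opt {V : Type*} (H : SimpleGraph V) (S : Finset V) (t₀ d₀ : ℕ) : Prop where
  min : ∀ t d, Cfg H S t d → d₀ + t ≤ d + t₀
  max : ∀ t d, Cfg H S t d → d + t₀ = d₀ + t → t ≤ t₀

lemma Conf.base {V : Type*} {H : SimpleGraph V} {S : Finset V} {𝒯 : Finset (Finset V)}
    {R X : Finset V} (h : Conf H S 𝒯 R X) {𝒯' : Finset (Finset V)} {R' Y : Finset V}
    (hT : 𝒯' ⊆ 𝒯) (hR : ∀ x ∈ R', x ∈ R ∨ x ∈ X) (hY : Y ⊆ X) (hRY : Disjoint R' Y)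
    (hpm : PM H Y) : ∃ S', Cfg H S' 𝒯'.card R'.card ∧
      ∀ x, x ∈ S' ↔ (∃ T ∈ 𝒯', x ∈ T) ∨ x ∈ R' ∨ x ∈ Y := by
  have hc : Conf H (𝒯'.biUnion id ∪ R' ∪ Y) 𝒯' R' Y := by
    refine ⟨fun T h1 => h.tri T (hT h1), fun T h1 T' h2 => h.dj T (hT h1) T' (hT h2), ?_, ?_, hRY,
      hpm, ?_⟩
    · intro T h1
      rw [Finset.disjoint_left]
      intro x hx hx'
      rcases hR x hx' with h2 | h2
      · exact Finset.disjoint_left.1 (h.dR T (hT h1)) hx h2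
      · exact Finset.disjoint_left.1 (h.dX T (hT h1)) hx h2
    · exact fun T h1 => (h.dX T (hT h1)).mono_right hY
    · intro x
      simp only [Finset.mem_union, Finset.mem_biUnion, id, or_assoc]
  exact ⟨_, hc.cfg, hc.un⟩

lemma Conf.notR {V : Type*} {H : SimpleGraph V} {S : Finset V} {𝒯 : Finset (Finset V)}
    {R X : Finset V} (h : Conf H S 𝒯 R X) {T : Finset V} (hT : T ∈ 𝒯) {x : V} (hx : x ∈ T) :
    x ∉ R ∧ x ∉ X ∧ ∀ T' ∈ 𝒯.erase T, x ∉ T' := by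
  refine ⟨fun e => Finset.disjoint_left.1 (h.dR T hT) hx e,
    fun e => Finset.disjoint_left.1 (h.dX T hT) hx e, fun T' hT' hx' => ?_⟩
  rw [Finset.mem_erase] at hT'
  exact Finset.disjoint_left.1 (h.dj T' hT'.2 T hT hT'.1) hx' hx

lemma Conf.notT {V : Type*} {H : SimpleGraph V} {S : Finset V} {𝒯 : Finset (Finset V)}
    {R X : Finset V} (h : Conf H S 𝒯 R X) {x : V} (hx : x ∈ R ∨ x ∈ X) :
    ∀ T ∈ 𝒯, x ∉ T := by
  intro T hT hxT
  have := h.notR hT hxT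
  tauto

lemma exists_erase {V : Type*} {𝒯 : Finset (Finset V)} {T : Finset V} (hT : T ∈ 𝒯) (x : V) :
    (∃ T' ∈ 𝒯, x ∈ T') ↔ x ∈ T ∨ ∃ T' ∈ 𝒯.erase T, x ∈ T' := by
  constructor
  · rintro ⟨T', h1, h2⟩
    by_cases e : T' = T
    · left; rwa [← e]
    · right; exact ⟨T', by simp [e, h1], h2⟩
  · rintro (h | ⟨T', h1, h2⟩)
    · exact ⟨T, hT, h⟩
    · exact ⟨T', Finset.mem_of_mem_erase h1, h2⟩

/-- Two singles are nonadjacent in an optimal configuration. -/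
lemma Conf.ex0 {V : Type*} {H : SimpleGraph V} {S : Finset V} {𝒯 : Finset (Finset V)}
    {R X : Finset V} (h : Conf H S 𝒯 R X) (ho : Opt H S 𝒯.card R.card) {u z : V}
    (hu : u ∈ R) (hz : z ∈ R) : ¬ H.Adj u z := by
  intro hadj
  have hne := hadj.ne
  obtain ⟨S', hS', hm⟩ := h.base (𝒯' := 𝒯) (R' := R \ {u, z}) (Y := X) (by simp)
    (fun x hx => Or.inl (Finset.mem_sdiff.1 hx).1) (by simp)
    (h.dRX.mono_left Finset.sdiff_subset) h.pm
  have u1 := h.notT (Or.inl hu)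
  have z1 := h.notT (Or.inl hz)
  have u2 : u ∉ X := fun e => Finset.disjoint_left.1 h.dRX hu e
  have z2 : z ∉ X := fun e => Finset.disjoint_left.1 h.dRX hz e
  have c1 := hS'.edge (x := u) (y := z) (by rw [hm]; simp [u2]; exact u1)
    (by rw [hm]; simp [z2]; exact z1) hadj
  have hS : insert u (insert z S') = S := by
    ext x
    simp only [Finset.mem_insert, hm, h.un x, Finset.mem_sdiff, Finset.mem_singleton]
    generalize (∃ T ∈ 𝒯, x ∈ T) = P
    by_cases e1 : x = u
    · subst e1; simp [hu]
    by_cases e2 : x = z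
    · subst e2; simp [hz]
    simp [e1, e2]
  rw [hS] at c1
  have := ho.min _ _ c1
  have hc : (R \ {u, z}).card = R.card - 2 := by
    rw [Finset.card_sdiff_of_subset, Finset.card_pair hne]
    intro x hx
    simp only [Finset.mem_insert, Finset.mem_singleton] at hx
    rcases hx with rfl | rfl <;> assumption
  have : 1 ≤ R.card := Finset.card_pos.2 ⟨u, hu⟩
  omega

/-- Preparation: removing a single `u` and two matched vertices `w, z`. -/
lemma Conf.prep {V : Type*} {H : SimpleGraph V} {S : Finset V} {𝒯 : Finset (Finset V)}
    {R X : Finset V} (h : Conf H S 𝒯 R X) {𝒯' : Finset (Finset V)} (hT : 𝒯' ⊆ 𝒯) {u w z : V}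
    (hu : u ∈ R) (hw : w ∈ X) (hz : z ∈ X) (hwz : w ≠ z) :
    ∃ S' d, Cfg H S' 𝒯'.card d ∧ (d + 1 = R.card ∨ d = R.card + 1) ∧
      (∀ x, x ∈ S' ↔ (∃ T ∈ 𝒯', x ∈ T) ∨ (x ∈ R ∧ x ≠ u) ∨ (x ∈ X ∧ x ≠ w ∧ x ≠ z)) := by
  have hRc : (R.erase u).card + 1 = R.card := Finset.card_erase_add_one hu
  rcases h.pm.remove_two hw hz hwz with hp | ⟨p, q, hpq, hp, hq, hpm⟩
  · obtain ⟨S', hS', hm⟩ := h.base (𝒯' := 𝒯') (R' := R.erase u) (Y := X \ {w, z}) hT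
      (fun x hx => Or.inl (Finset.mem_of_mem_erase hx)) Finset.sdiff_subset
      ((h.dRX.mono_left (Finset.erase_subset _ _)).mono_right Finset.sdiff_subset) hp
    refine ⟨S', _, hS', Or.inl hRc, fun x => ?_⟩
    rw [hm]
    simp only [Finset.mem_erase, Finset.mem_sdiff, Finset.mem_insert, Finset.mem_singleton, not_or]
    generalize (∃ T ∈ 𝒯', x ∈ T) = P
    tauto
  · have hdd : Disjoint (R.erase u) ({p, q} : Finset V) := by
      rw [Finset.disjoint_left]
      intro x hx hx'
      have hxX : x ∈ X := by
        simp only [Finset.mem_insert, Finset.mem_singleton] at hx'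
        rcases hx' with rfl | rfl
        · exact (Finset.mem_sdiff.1 hp).1
        · exact (Finset.mem_sdiff.1 hq).1
      exact Finset.disjoint_left.1 h.dRX (Finset.mem_of_mem_erase hx) hxX
    obtain ⟨S', hS', hm⟩ := h.base (𝒯' := 𝒯') (R' := R.erase u ∪ {p, q})
      (Y := (X \ {w, z}) \ {p, q}) hT (by
        intro x hx
        simp only [Finset.mem_union, Finset.mem_erase, Finset.mem_insert,
          Finset.mem_singleton] at hx
        rcases hx with hx | rfl | rfl
        · exact Or.inl hx.2
        · exact Or.inr (Finset.mem_sdiff.1 hp).1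
        · exact Or.inr (Finset.mem_sdiff.1 hq).1)
      (Finset.sdiff_subset.trans Finset.sdiff_subset) (by
        rw [Finset.disjoint_union_left]
        refine ⟨(h.dRX.mono_left (Finset.erase_subset _ _)).mono_right
          (Finset.sdiff_subset.trans Finset.sdiff_subset), Finset.disjoint_sdiff⟩) hpm
    refine ⟨S', _, hS', Or.inr ?_, fun x => ?_⟩
    · rw [Finset.card_union_of_disjoint hdd, Finset.card_pair hpq]; omega
    · rw [hm]
      simp only [Finset.mem_erase, Finset.mem_sdiff, Finset.mem_insert, Finset.mem_singleton,
        not_or, Finset.mem_union] at hp hq ⊢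
      generalize (∃ T ∈ 𝒯', x ∈ T) = P
      by_cases e1 : x = p
      · subst e1; simp [hp]
      by_cases e2 : x = q
      · subst e2; simp [hq]
      simp only [e1, e2]
      tauto

lemma Conf.ex1 {V : Type*} {H : SimpleGraph V} {S : Finset V} {𝒯 : Finset (Finset V)}
    {R X : Finset V} (h : Conf H S 𝒯 R X) (ho : Opt H S 𝒯.card R.card) {u w z : V}
    (hu : u ∈ R) (hw : w ∈ X) (hz : z ∈ X) (h1 : H.Adj u w) (h2 : H.Adj u z)
    (h3 : H.Adj w z) : False := by
  obtain ⟨S', d, hS', hd, hm⟩ := h.prep (𝒯' := 𝒯) (by simp) hu hw hz h3.ne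
  have n1 := h1.ne
  have n2 := h2.ne
  have n3 := h3.ne
  have u1 := h.notT (Or.inl hu)
  have z1 := h.notT (Or.inr hz)
  have w1 := h.notT (Or.inr hw)
  have u2 : u ∉ X := fun e => Finset.disjoint_left.1 h.dRX hu e
  have z2 : z ∉ R := fun e => Finset.disjoint_left.1 h.dRX e hz
  have w2 : w ∉ R := fun e => Finset.disjoint_left.1 h.dRX e hw
  have c1 := hS'.tri (x := u) (y := w) (z := z) (by rw [hm]; simp [u2]; exact u1)
    (by rw [hm]; simp [w2]; exact w1) (by rw [hm]; simp [z2]; exact z1) h1 h2 h3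
  have hS : insert u (insert w (insert z S')) = S := by
    ext x
    simp only [Finset.mem_insert, hm, h.un x]
    generalize (∃ T ∈ 𝒯, x ∈ T) = P
    by_cases e1 : x = u
    · subst e1; simp [hu]
    by_cases e2 : x = w
    · subst e2; simp [hw]
    by_cases e3 : x = z
    · subst e3; simp [hz]
    simp [e1, e2, e3]
  rw [hS] at c1
  have a1 := ho.min _ _ c1
  have a2 := ho.max _ _ c1
  omega

lemma Conf.ex2 {V : Type*} {H : SimpleGraph V} {S : Finset V} {𝒯 : Finset (Finset V)}
    {R X : Finset V} (h : Conf H S 𝒯 R X) (ho : Opt H S 𝒯.card R.card) {u z a b c : V}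
    (hu : u ∈ R) (hz : z ∈ R) (huz : u ≠ z) (hT : ({a, b, c} : Finset V) ∈ 𝒯)
    (hab : a ≠ b) (hbc : b ≠ c)
    (h1 : H.Adj u b) (h2 : H.Adj a z) (h3 : H.Adj a c) (h4 : H.Adj z c) : False := by
  obtain ⟨S', hS', hm⟩ := h.base (𝒯' := 𝒯.erase {a, b, c}) (R' := R \ {u, z}) (Y := X)
    (Finset.erase_subset _ _)
    (fun x hx => Or.inl (Finset.mem_sdiff.1 hx).1) (by simp)
    (h.dRX.mono_left Finset.sdiff_subset) h.pm
  have u1 : ¬ ∃ T ∈ 𝒯.erase {a, b, c}, u ∈ T := fun ⟨T, e1, e2⟩ =>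
    h.notT (Or.inl hu) T (Finset.mem_of_mem_erase e1) e2
  have z1 : ¬ ∃ T ∈ 𝒯.erase {a, b, c}, z ∈ T := fun ⟨T, e1, e2⟩ =>
    h.notT (Or.inl hz) T (Finset.mem_of_mem_erase e1) e2
  have u2 : u ∉ X := fun e => Finset.disjoint_left.1 h.dRX hu e
  have z2 : z ∉ X := fun e => Finset.disjoint_left.1 h.dRX hz e
  have hS0 : ∀ v ∈ ({a, b, c} : Finset V), v ∉ S' := by
    intro v hv
    obtain ⟨g1, g2, g3⟩ := h.notR hT hv
    rw [hm]
    rintro (⟨T', e1, e2⟩ | e | e)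
    · exact g3 T' e1 e2
    · exact g1 (Finset.mem_sdiff.1 e).1
    · exact g2 e
  have hua : u ≠ a := fun e => (h.notR hT (x := a) (by simp)).1 (e ▸ hu)
  have huc : u ≠ c := fun e => (h.notR hT (x := c) (by simp)).1 (e ▸ hu)
  have hzb : z ≠ b := fun e => (h.notR hT (x := b) (by simp)).1 (e ▸ hz)
  have a0 := hS0 a (by simp)
  have b0 := hS0 b (by simp)
  have c0 := hS0 c (by simp)
  have u0 : u ∉ S' := by rw [hm]; simp [u2]; simpa using u1
  have z0 : z ∉ S' := by rw [hm]; simp [z2]; simpa using z1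
  have c1 := (hS'.edge u0 b0 h1).tri (x := a) (y := z) (z := c)
    (by simp [hua.symm, hab, a0]) (by simp [huz.symm, hzb, z0]) (by simp [huc.symm, hbc.symm, c0])
    h2 h3 h4
  have hS : insert a (insert z (insert c (insert u (insert b S')))) = S := by
    ext x
    have hex := exists_erase hT x
    rw [h.un x, hex]
    simp only [Finset.mem_insert, hm, Finset.mem_sdiff, Finset.mem_singleton]
    generalize (∃ T ∈ 𝒯.erase {a, b, c}, x ∈ T) = P
    by_cases e1 : x = u
    · subst e1; simp [hu]
    by_cases e2 : x = z
    · subst e2; simp [hz]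
    by_cases e4 : x = a
    · simp [e4]
    by_cases e5 : x = b
    · simp [e5]
    by_cases e6 : x = c
    · simp [e6]
    simp [e1, e2, e4, e5, e6]
  rw [hS] at c1
  have := ho.min _ _ c1
  have hc : (R \ {u, z}).card = R.card - 2 := by
    rw [Finset.card_sdiff_of_subset, Finset.card_pair huz]
    intro x hx
    simp only [Finset.mem_insert, Finset.mem_singleton] at hx
    rcases hx with rfl | rfl <;> assumption
  have e1 : 1 ≤ R.card := Finset.card_pos.2 ⟨u, hu⟩
  have e2 := Finset.card_erase_add_one hT
  omega

lemma Conf.ex3 {V : Type*} {H : SimpleGraph V} {S : Finset V} {𝒯 : Finset (Finset V)}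
    {R X : Finset V} (h : Conf H S 𝒯 R X) (ho : Opt H S 𝒯.card R.card) {u w z a b c : V}
    (hu : u ∈ R) (hw : w ∈ X) (hz : z ∈ X) (hT : ({a, b, c} : Finset V) ∈ 𝒯)
    (hab : a ≠ b) (hac : a ≠ c)
    (h1 : H.Adj w a) (h2 : H.Adj w z) (h3 : H.Adj a z)
    (h4 : H.Adj u b) (h5 : H.Adj u c) (h6 : H.Adj b c) : False := by
  obtain ⟨S', d, hS', hd, hm⟩ := h.prep (𝒯' := 𝒯.erase {a, b, c}) (Finset.erase_subset _ _)
    hu hw hz h2.ne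
  have n1 : ∀ v, v ∈ R ∨ v ∈ X → ¬ ∃ T ∈ 𝒯.erase {a, b, c}, v ∈ T := fun v hv ⟨T, e1, e2⟩ =>
    h.notT hv T (Finset.mem_of_mem_erase e1) e2
  have n2 : ∀ v, v ∈ R → v ∉ X := fun v hv e => Finset.disjoint_left.1 h.dRX hv e
  have hS0 : ∀ v ∈ ({a, b, c} : Finset V), v ∉ S' := by
    intro v hv
    obtain ⟨g1, g2, g3⟩ := h.notR hT hv
    rw [hm]
    rintro (⟨T', e1, e2⟩ | e | e)
    · exact g3 T' e1 e2
    · exact g1 e.1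
    · exact g2 e.1
  have hne : ∀ v, v ∈ R ∨ v ∈ X → v ≠ a ∧ v ≠ b ∧ v ≠ c := by
    intro v hv
    have := h.notT hv _ hT
    simpa using this
  have u0 : u ∉ S' := by
    rw [hm]
    rintro (e | e | e)
    · exact n1 u (Or.inl hu) e
    · exact e.2 rfl
    · exact n2 u hu e.1
  have z0 : z ∉ S' := by
    rw [hm]
    rintro (e | e | e)
    · exact n1 z (Or.inr hz) e
    · exact n2 z e.1 hz
    · exact e.2.2 rfl
  have w0 : w ∉ S' := by
    rw [hm]
    rintro (e | e | e)
    · exact n1 w (Or.inr hw) e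
    · exact n2 w e.1 hw
    · exact e.2.1 rfl
  have a0 := hS0 a (by simp)
  have b0 := hS0 b (by simp)
  have c0 := hS0 c (by simp)
  obtain ⟨k1, k2, k3⟩ := hne u (Or.inl hu)
  obtain ⟨k4, k5, k6⟩ := hne w (Or.inr hw)
  obtain ⟨k7, k8, k9⟩ := hne z (Or.inr hz)
  have uw : w ≠ u := fun e => n2 u hu (e ▸ hw)
  have uz : z ≠ u := fun e => n2 u hu (e ▸ hz)
  have c1 := (hS'.tri u0 b0 c0 h4 h5 h6).tri (x := w) (y := a) (z := z)
    (by simp [uw, k5, k6, w0]) (by simp [k1.symm, hab, hac, a0]) (by simp [uz, k8, k9, z0])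
    h1 h2 h3
  have hS : insert w (insert a (insert z (insert u (insert b (insert c S'))))) = S := by
    ext x
    have hex := exists_erase hT x
    rw [h.un x, hex]
    simp only [Finset.mem_insert, hm, Finset.mem_singleton]
    generalize (∃ T ∈ 𝒯.erase {a, b, c}, x ∈ T) = P
    by_cases e1 : x = u
    · subst e1; simp [hu]
    by_cases e2 : x = z
    · subst e2; simp [hz]
    by_cases e3 : x = w
    · subst e3; simp [hw]
    by_cases e4 : x = a
    · simp [e4]
    by_cases e5 : x = b
    · simp [e5]
    by_cases e6 : x = c
    · simp [e6]
    simp [e1, e2, e3, e4, e5, e6]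
  rw [hS] at c1
  have a1 := ho.min _ _ c1
  have a2 := ho.max _ _ c1
  have e2 := Finset.card_erase_add_one hT
  omega


lemma fin3_third : ∀ p q r s : Fin 3, p ≠ q → r ≠ p → r ≠ q → s ≠ p → s ≠ q → r = s := by
  decide

lemma fin3_ex : ∀ p q : Fin 3, ∃ r : Fin 3, r ≠ p ∧ r ≠ q := by decide

/-- Naming the vertices of a triangle according to their parts. -/
lemma tri_parts {V : Type*} {H : SimpleGraph V} {part : V → Fin 3}
    (hpart : ∀ x y, H.Adj x y → part x ≠ part y) {T : Finset V} (hT : H.IsNClique 3 T)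
    {p q : Fin 3} (hpq : p ≠ q) :
    ∃ a b c, T = {a, b, c} ∧ part a = p ∧ part b = q ∧ H.Adj a b ∧ H.Adj a c ∧ H.Adj b c := by
  have hinj : Set.InjOn part (T : Set V) := by
    intro x hx y hy hxy
    by_contra hne
    exact hpart x y (hT.isClique hx hy hne) hxy
  have himg : T.image part = Finset.univ := by
    apply Finset.eq_univ_of_card
    rw [Finset.card_image_of_injOn hinj, hT.card_eq]
    rfl
  have hget : ∀ r : Fin 3, ∃ x ∈ T, part x = r := by
    intro r
    have : r ∈ T.image part := by rw [himg]; simp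
    simpa using this
  obtain ⟨r, hr1, hr2⟩ := fin3_ex p q
  obtain ⟨a, ha, ha'⟩ := hget p
  obtain ⟨b, hb, hb'⟩ := hget q
  obtain ⟨c, hc, hc'⟩ := hget r
  have hab : a ≠ b := fun e => hpq (by rw [← ha', ← hb', e])
  have hac : a ≠ c := fun e => hr1 (by rw [← ha', ← hc', e])
  have hbc : b ≠ c := fun e => hr2 (by rw [← hb', ← hc', e])
  refine ⟨a, b, c, ?_, ha', hb', hT.isClique ha hb hab, hT.isClique ha hc hac,
    hT.isClique hb hc hbc⟩
  symm
  apply Finset.eq_of_subset_of_card_le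
  · intro x hx
    simp only [Finset.mem_insert, Finset.mem_singleton] at hx
    rcases hx with rfl | rfl | rfl <;> assumption
  · rw [hT.card_eq, Finset.card_eq_three.2 ⟨a, b, c, hab, hac, hbc, rfl⟩]

lemma two_nb {V : Type*} {H : SimpleGraph V} {part : V → Fin 3}
    (hpart : ∀ x y, H.Adj x y → part x ≠ part y) {a b c u : V} 
    (hpa : part a = part u) (h2 : 2 ≤ (nb H {a, b, c} u).card) : H.Adj u b ∧ H.Adj u c := by
  have hsub : nb H {a, b, c} u ⊆ {b, c} := by
    intro x hx
    rw [mem_nb] at hx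
    simp only [Finset.mem_insert, Finset.mem_singleton] at hx ⊢
    rcases hx with ⟨rfl | h | h, hadj⟩
    · exact absurd hpa.symm (hpart _ _ hadj)
    · exact Or.inl h
    · exact Or.inr h
  have heq : nb H {a, b, c} u = {b, c} :=
    Finset.eq_of_subset_of_card_le hsub (Finset.card_le_two.trans h2)
  have hb : b ∈ nb H {a, b, c} u := by rw [heq]; simp
  have hc : c ∈ nb H {a, b, c} u := by rw [heq]; simp
  exact ⟨(mem_nb.1 hb).2, (mem_nb.1 hc).2⟩

lemma exists_K {V : Type*} {H : SimpleGraph V} {part : V → Fin 3}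
    (hpart : ∀ x y, H.Adj x y → part x ≠ part y)
    (hdom : ∀ x y z w, H.Adj x y → H.Adj x z → H.Adj y z → w ≠ x → w ≠ y → w ≠ z →
      H.Adj w x ∨ H.Adj w y ∨ H.Adj w z)
    {S : Finset V} {𝒯 : Finset (Finset V)} {R0 W P : Finset V} {u : V}
    (htri : ∀ T ∈ 𝒯, H.IsNClique 3 T)
    (hdj : ∀ T ∈ 𝒯, ∀ T' ∈ 𝒯, T ≠ T' → Disjoint T T')
    (hdR : ∀ T ∈ 𝒯, Disjoint T R0) (hdW : ∀ T ∈ 𝒯, Disjoint T W) (hRW : Disjoint R0 W)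
    (hun : ∀ x, x ∈ S ↔ (∃ T ∈ 𝒯, x ∈ T) ∨ x ∈ R0 ∨ x ∈ W)
    (hPW : P ⊆ W) (hu : u ∈ P) (hdeg : (nb H W u).card ≤ P.card)
    (hind : ∀ x ∈ P ∪ R0, ∀ y ∈ P ∪ R0, ¬ H.Adj x y)
    (hbad : ∀ z ∈ P ∪ R0, ∀ T ∈ 𝒯, 2 ≤ (nb H T u).card → 2 ≤ (nb H T z).card →
      part z = part u) :
    ∃ K ⊆ S, u ∈ K ∧ (∀ x ∈ K, ∀ y ∈ K, ¬ H.Adj x y) ∧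
      (nb H S u).card + R0.card ≤ K.card + 𝒯.card := by
  have hT0 : ∀ T ∈ 𝒯, ∃ a ∈ T, part a = part u := by
    intro T hT
    obtain ⟨r, hr, -⟩ := fin3_ex (part u) (part u)
    obtain ⟨a, b, c, rfl, ha, -⟩ := tri_parts hpart (htri T hT) hr.symm
    exact ⟨a, by simp, ha⟩
  have : Nonempty V := ⟨u⟩
  choose! α hα1 hα2 using hT0
  set 𝒯₂ := 𝒯.filter (fun T => 2 ≤ (nb H T u).card) with h𝒯₂
  have hS2 : ∀ T ∈ 𝒯₂, T ∈ 𝒯 ∧ 2 ≤ (nb H T u).card := fun T hT => by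
    simpa [h𝒯₂] using hT
  have hPR_S : ∀ x ∈ P ∪ R0, x ∈ S ∧ ∀ T ∈ 𝒯, x ∉ T := by
    intro x hx
    rcases Finset.mem_union.1 hx with h | h
    · exact ⟨(hun x).2 (Or.inr (Or.inr (hPW h))),
        fun T hT hxT => Finset.disjoint_left.1 (hdW T hT) hxT (hPW h)⟩
    · exact ⟨(hun x).2 (Or.inr (Or.inl h)),
        fun T hT hxT => Finset.disjoint_left.1 (hdR T hT) hxT h⟩
  have hcross : ∀ z ∈ P ∪ R0, ∀ T ∈ 𝒯₂, ¬ H.Adj z (α T) := by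
    intro z hz T hT hadj
    obtain ⟨hT1, hT2⟩ := hS2 T hT
    have hzu : part z ≠ part u := by
      rw [← hα2 T hT1]; exact hpart _ _ hadj
    obtain ⟨a, b, c, rfl, ha, hb, hab, hac, hbc⟩ := tri_parts hpart (htri T hT1) hzu.symm
    have haα : α {a, b, c} = a := by
      have h1 := hα1 _ hT1
      have h2 := hα2 _ hT1
      simp only [Finset.mem_insert, Finset.mem_singleton] at h1
      rcases h1 with h1 | h1 | h1
      · exact h1
      · rw [h1, hb] at h2; exact absurd h2 hzu
      · rw [h1, ← ha] at h2; exact absurd h2.symm (hpart _ _ hac)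
    rw [haα] at hadj
    obtain ⟨hub, huc⟩ := two_nb hpart ha hT2
    have hzT := (hPR_S z hz).2 _ hT1
    simp only [Finset.mem_insert, Finset.mem_singleton, not_or] at hzT
    have hzu' : z ≠ u := fun e => hzu (by rw [e])
    have hzc : H.Adj z c := by
      rcases hdom u b c z hub huc hbc hzu' hzT.2.1 hzT.2.2 with h | h | h
      · exact absurd h (hind z hz u (by simp [hu]))
      · exact absurd hb.symm (hpart _ _ h)
      · exact h
    have h2z : 2 ≤ (nb H {a, b, c} z).card := by
      rw [← Finset.card_pair hac.ne]
      apply Finset.card_le_card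
      intro x hx
      simp only [Finset.mem_insert, Finset.mem_singleton] at hx
      rw [mem_nb]
      rcases hx with rfl | rfl
      · exact ⟨by simp, hadj⟩
      · exact ⟨by simp, hzc⟩
    exact hzu (hbad z hz _ hT1 hT2 h2z)
  refine ⟨(P ∪ R0) ∪ 𝒯₂.image α, ?_, by simp [hu], ?_, ?_⟩
  · intro x hx
    rcases Finset.mem_union.1 hx with h | h
    · exact (hPR_S x h).1
    · obtain ⟨T, hT, rfl⟩ := Finset.mem_image.1 h
      exact (hun _).2 (Or.inl ⟨T, (hS2 T hT).1, hα1 T (hS2 T hT).1⟩)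
  · intro x hx y hy hadj
    rcases Finset.mem_union.1 hx with h | h <;> rcases Finset.mem_union.1 hy with h' | h'
    · exact hind x h y h' hadj
    · obtain ⟨T, hT, rfl⟩ := Finset.mem_image.1 h'
      exact hcross x h T hT hadj
    · obtain ⟨T, hT, rfl⟩ := Finset.mem_image.1 h
      exact hcross y h' T hT hadj.symm
    · obtain ⟨T, hT, rfl⟩ := Finset.mem_image.1 h
      obtain ⟨T', hT', rfl⟩ := Finset.mem_image.1 h'
      refine hpart _ _ hadj ?_
      rw [hα2 T (hS2 T hT).1, hα2 T' (hS2 T' hT').1]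
  · have hKc : ((P ∪ R0) ∪ 𝒯₂.image α).card = P.card + R0.card + 𝒯₂.card := by
      rw [Finset.card_union_of_disjoint, Finset.card_union_of_disjoint, Finset.card_image_of_injOn]
      · intro T hT T' hT' he
        by_contra hne
        have t1 := (hS2 T hT).1
        have t2 := (hS2 T' hT').1
        exact Finset.disjoint_left.1 (hdj T t1 T' t2 hne) (hα1 T t1) (by
          rw [he]; exact hα1 T' t2)
      · exact (hRW.mono_right hPW).symm
      · rw [Finset.disjoint_left]
        intro x hx hx'
        obtain ⟨T, hT, rfl⟩ := Finset.mem_image.1 hx'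
        exact (hPR_S _ hx).2 T (hS2 T hT).1 (hα1 T (hS2 T hT).1)
    have hsub : nb H S u ⊆ nb H W u ∪ 𝒯.biUnion (fun T => nb H T u) := by
      intro x hx
      rw [mem_nb] at hx
      simp only [Finset.mem_union, Finset.mem_biUnion, mem_nb]
      rcases (hun x).1 hx.1 with ⟨T, hT, hxT⟩ | h | h
      · exact Or.inr ⟨T, hT, hxT, hx.2⟩
      · exact absurd hx.2 (hind u (by simp [hu]) x (by simp [h]))
      · exact Or.inl ⟨h, hx.2⟩
    have h1 := (Finset.card_le_card hsub).trans (Finset.card_union_le _ _)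
    have h2 := Finset.card_biUnion_le (s := 𝒯) (t := fun T => nb H T u)
    have h3 : ∑ T ∈ 𝒯, (nb H T u).card ≤ ∑ T ∈ 𝒯, (1 + if 2 ≤ (nb H T u).card then 1 else 0) := by
      apply Finset.sum_le_sum
      intro T hT
      have h4 : (nb H T u).card ≤ 2 := by
        have : nb H T u ⊆ T.erase (α T) := by
          intro x hx
          rw [mem_nb] at hx
          rw [Finset.mem_erase]
          refine ⟨?_, hx.1⟩
          rintro rfl
          exact hpart _ _ hx.2 (hα2 T hT).symm
        have h5 := Finset.card_le_card this
        rw [Finset.card_erase_of_mem (hα1 T hT), (htri T hT).card_eq] at h5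
        exact h5
      split_ifs <;> omega
    rw [Finset.sum_add_distrib, ← Finset.card_filter, ← h𝒯₂] at h3
    simp only [Finset.sum_const, smul_eq_mul, mul_one] at h3
    omega

theorem key {V : Type*} {H : SimpleGraph V} {part : V → Fin 3}
    (hpart : ∀ x y, H.Adj x y → part x ≠ part y)
    (hdom : ∀ x y z w, H.Adj x y → H.Adj x z → H.Adj y z → w ≠ x → w ≠ y → w ≠ z →
      H.Adj w x ∨ H.Adj w y ∨ H.Adj w z)
    {S : Finset V} {𝒯 : Finset (Finset V)} {R X : Finset V} (h : Conf H S 𝒯 R X)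
    (ho : Opt H S 𝒯.card R.card) (hR : R.Nonempty) :
    ∃ u ∈ S, ∃ K ⊆ S, u ∈ K ∧ (∀ x ∈ K, ∀ y ∈ K, ¬ H.Adj x y) ∧
      (nb H S u).card + R.card ≤ K.card + 1 + 𝒯.card := by
  obtain ⟨r, hr⟩ := hR
  have hrX : r ∉ X := fun e => Finset.disjoint_left.1 h.dRX hr e
  set R0 := R.erase r with hR0
  set W := insert r X with hW
  have hWr : W.erase r = X := Finset.erase_insert hrX
  have hR0c : R0.card + 1 = R.card := Finset.card_erase_add_one hr
  have hrR0 : r ∉ R0 := by simp [hR0]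
  have hRW : Disjoint R0 W := by
    rw [hW, Finset.disjoint_insert_right]
    exact ⟨hrR0, h.dRX.mono_left (Finset.erase_subset _ _)⟩
  have hdR : ∀ T ∈ 𝒯, Disjoint T R0 := fun T hT => (h.dR T hT).mono_right (Finset.erase_subset _ _)
  have hdW : ∀ T ∈ 𝒯, Disjoint T W := by
    intro T hT
    rw [hW, Finset.disjoint_insert_right]
    exact ⟨h.notT (Or.inl hr) T hT, h.dX T hT⟩
  have hun : ∀ x, x ∈ S ↔ (∃ T ∈ 𝒯, x ∈ T) ∨ x ∈ R0 ∨ x ∈ W := by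
    intro x
    rw [h.un]
    simp only [hR0, hW, Finset.mem_erase, Finset.mem_insert]
    generalize (∃ T ∈ 𝒯, x ∈ T) = P
    by_cases e : x = r
    · subst e; simp [hr]
    · simp [e]
  obtain ⟨Q, hQW, hQ, hcase⟩ := exists_good_vertex H W (v := r) (by simp [hW])
    (by rw [hWr]; exact h.pm)
  have hconf : ∀ u ∈ Q, Conf H S 𝒯 (insert u R0) (W.erase u) ∧
      Opt H S 𝒯.card (insert u R0).card := by
    intro u hu
    have huW := hQW hu
    have huR0 : u ∉ R0 := fun e => Finset.disjoint_left.1 hRW e huW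
    refine ⟨⟨h.tri, h.dj, ?_, ?_, ?_, hQ u hu, ?_⟩, ?_⟩
    · intro T hT
      rw [Finset.disjoint_insert_right]
      exact ⟨fun e => Finset.disjoint_left.1 (hdW T hT) e huW, hdR T hT⟩
    · exact fun T hT => (hdW T hT).mono_right (Finset.erase_subset _ _)
    · rw [Finset.disjoint_insert_left]
      exact ⟨by simp, hRW.mono_right (Finset.erase_subset _ _)⟩
    · intro x
      rw [hun x]
      simp only [Finset.mem_insert, Finset.mem_erase]
      generalize (∃ T ∈ 𝒯, x ∈ T) = P
      by_cases e : x = u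
      · subst e; simp [huW]
      · simp [e]
    · rw [Finset.card_insert_of_notMem huR0, hR0c]
      exact ho
  have hRind : ∀ u ∈ Q, ∀ x ∈ insert u R0, ∀ y ∈ insert u R0, ¬ H.Adj x y := by
    intro u hu x hx y hy
    exact (hconf u hu).1.ex0 (hconf u hu).2 hx hy
  have hbadR : ∀ u ∈ Q, ∀ z ∈ R0, ∀ T ∈ 𝒯, 2 ≤ (nb H T u).card → 2 ≤ (nb H T z).card →
      part z = part u := by
    intro u hu z hz T hT h2u h2z
    by_contra hne
    obtain ⟨a, b, c, rfl, ha, hb, hab, hac, hbc⟩ := tri_parts hpart (h.tri T hT) (Ne.symm hne)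
    obtain ⟨hub, huc⟩ := two_nb hpart ha h2u
    rw [Finset.insert_comm] at h2z
    obtain ⟨hza, hzc⟩ := two_nb hpart hb h2z
    exact (hconf u hu).1.ex2 (hconf u hu).2 (u := u) (z := z) (by simp) (by simp [hz])
      (fun e => hne (by rw [e])) hT hab.ne hbc.ne hub hza.symm hac hzc
  suffices hmain : ∃ u ∈ Q, ∃ P ⊆ Q, u ∈ P ∧ (nb H W u).card ≤ P.card ∧
      (∀ x ∈ P, ∀ y ∈ P, ¬ H.Adj x y) ∧
      (∀ z ∈ P, ∀ T ∈ 𝒯, 2 ≤ (nb H T u).card → 2 ≤ (nb H T z).card → part z = part u) by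
    obtain ⟨u, hu, P, hPQ, huP, hdeg, hPind, hPbad⟩ := hmain
    obtain ⟨K, hK1, hK2, hK3, hK4⟩ := exists_K hpart hdom h.tri h.dj hdR hdW hRW hun
      (hPQ.trans hQW) huP hdeg (by
        intro x hx y hy hadj
        rcases Finset.mem_union.1 hx with e | e <;> rcases Finset.mem_union.1 hy with e' | e'
        · exact hPind x e y e' hadj
        · exact hRind x (hPQ e) x (by simp) y (by simp [e']) hadj
        · exact hRind y (hPQ e') x (by simp [e]) y (by simp) hadj
        · exact hRind u hu x (by simp [e]) y (by simp [e']) hadj)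
      (by
        intro z hz
        rcases Finset.mem_union.1 hz with e | e
        · exact hPbad z e
        · exact hbadR u hu z e)
    exact ⟨u, (hun u).2 (Or.inr (Or.inr (hQW hu))), K, hK1, hK2, hK3, by omega⟩
  rcases hcase with ⟨u, hu, hempty⟩ | ⟨w, hw, u, hu, hwu, hdeg⟩
  · refine ⟨u, hu, {u}, by simpa using hu, by simp, by simp [hempty], ?_, ?_⟩
    · intro x hx y hy
      simp only [Finset.mem_singleton] at hx hy
      subst hx; subst hy
      exact H.loopless.irrefl _
    · intro z hz
      simp only [Finset.mem_singleton] at hz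
      subst hz
      intros; rfl
  · refine ⟨u, hu, nb H Q w, Finset.filter_subset _ _, mem_nb.2 ⟨hu, hwu⟩, hdeg, ?_, ?_⟩
    · intro x hx y hy hadj
      rw [mem_nb] at hx hy
      exact (hconf x hx.1).1.ex1 (hconf x hx.1).2 (u := x) (w := w) (z := y) (by simp)
        (by simp [hw, hx.2.ne]) (by simp [hQW hy.1, hadj.ne.symm]) hx.2.symm hadj hy.2
    · intro z hz T hT h2u h2z
      rw [mem_nb] at hz
      by_contra hne
      have hne' : z ≠ u := fun e => hne (by rw [e])
      obtain ⟨a, b, c, rfl, ha, hb, hab, hac, hbc⟩ := tri_parts hpart (h.tri T hT) (Ne.symm hne)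
      obtain ⟨hub, huc⟩ := two_nb hpart ha h2u
      have h2z' := h2z
      rw [Finset.insert_comm] at h2z'
      obtain ⟨hza, hzc⟩ := two_nb hpart hb h2z'
      have hwc : part w = part c := by
        refine fin3_third (part u) (part z) _ _ (Ne.symm hne) (hpart _ _ hwu) (hpart _ _ hz.2) ?_ ?_
        · exact (hpart _ _ huc).symm
        · exact (hpart _ _ hzc).symm
      have hwT : w ∉ ({a, b, c} : Finset V) := fun e => Finset.disjoint_left.1 (hdW _ hT) e hw
      simp only [Finset.mem_insert, Finset.mem_singleton, not_or] at hwT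
      rcases hdom a b c w hab hac hbc hwT.1 hwT.2.1 hwT.2.2 with e | e | e
      · exact (hconf u hu).1.ex3 (hconf u hu).2 (u := u) (w := w) (z := z) (by simp)
          (by simp [hw, hwu.ne]) (by simp [hQW hz.1, hne']) hT hab.ne hac.ne e hz.2 hza.symm
          hub huc hbc
      · rw [Finset.insert_comm] at hT
        exact (hconf z hz.1).1.ex3 (hconf z hz.1).2 (u := z) (w := w) (z := u) (by simp)
          (by simp [hw, hz.2.ne]) (by simp [hQW hu, hne'.symm]) hT hab.ne.symm hbc.ne e hwu hub.symm
          hza hzc hac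
      · exact hpart _ _ e hwc

lemma Cfg.card_le {V : Type*} {H : SimpleGraph V} {S : Finset V} {t d : ℕ} (h : Cfg H S t d) :
    t ≤ S.card := by
  induction h with
  | empty => simp
  | @tri S t d x y z _ hx hy hz _ _ _ ih =>
    have h1 : (insert z S).card = S.card + 1 := Finset.card_insert_of_notMem hz
    have h2 : (insert z S).card ≤ (insert x (insert y (insert z S))).card :=
      Finset.card_le_card ((Finset.subset_insert _ _).trans (Finset.subset_insert _ _))
    omega
  | @single S t d x _ hx ih =>
    exact ih.trans (Finset.card_le_card (Finset.subset_insert _ _))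
  | @edge S t d x y _ hx hy _ ih =>
    exact ih.trans (Finset.card_le_card
      ((Finset.subset_insert _ _).trans (Finset.subset_insert _ _)))

lemma exists_core {V : Type*} [Fintype V] {H : SimpleGraph V} {part : V → Fin 3}
    (hpart : ∀ x y, H.Adj x y → part x ≠ part y)
    (hdom : ∀ x y z w, H.Adj x y → H.Adj x z → H.Adj y z → w ≠ x → w ≠ y → w ≠ z →
      H.Adj w x ∨ H.Adj w y ∨ H.Adj w z) (k : ℕ)
    (hbad : ∀ t d, Cfg H Finset.univ t d → 2 * k + 2 + t ≤ (Finset.univ : Finset V).card + d) :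
    ∃ S : Finset V, ∃ u ∈ S, ∃ K ⊆ S, u ∈ K ∧ (∀ x ∈ K, ∀ y ∈ K, ¬ H.Adj x y) ∧
      (nb H S u).card + 2 * k + 1 ≤ K.card + S.card := by
  let Bad : Finset V → Prop := fun S => ∀ t d, Cfg H S t d → 2 * k + 2 + t ≤ S.card + d
  have hex : ∃ n, ∃ S : Finset V, S.card = n ∧ Bad S := ⟨_, Finset.univ, rfl, hbad⟩
  obtain ⟨S, hSn, hSB⟩ := Nat.find_spec hex
  have hmin : ∀ S' : Finset V, S'.card < S.card → ¬ Bad S' := by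
    intro S' hlt hB
    rw [hSn] at hlt
    exact Nat.find_min hex hlt ⟨S', rfl, hB⟩
  have hne : S.Nonempty := by
    rw [Finset.nonempty_iff_ne_empty]
    rintro rfl
    have := hSB 0 0 Cfg.empty
    simp at this
  obtain ⟨v, hv⟩ := hne
  have hlt : (S.erase v).card < S.card := Finset.card_erase_lt_of_mem hv
  have hc : (S.erase v).card + 1 = S.card := Finset.card_erase_add_one hv
  have hnb := hmin _ hlt
  simp only [Bad, not_forall, not_le] at hnb
  obtain ⟨t, d, hcfg, hlt2⟩ := hnb
  have hcfg2 : Cfg H S t (d + 1) := by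
    have := hcfg.single (Finset.notMem_erase v S)
    rwa [Finset.insert_erase hv] at this
  have heq : S.card + (d + 1) = 2 * k + 2 + t := by
    obtain ⟨m, hm, -⟩ := hcfg2.colour
    have := hSB _ _ hcfg2
    omega
  let P : ℕ → Prop := fun t => ∃ d, 1 ≤ d ∧ Cfg H S t d ∧ S.card + d = 2 * k + 2 + t
  have hPt : P t := ⟨d + 1, by omega, hcfg2, heq⟩
  have hPg : P (Nat.findGreatest P S.card) := Nat.findGreatest_spec hcfg2.card_le hPt
  have hPmax : ∀ t', P t' → t' ≤ Nat.findGreatest P S.card := by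
    rintro t' ⟨d', h1, h2, h3⟩
    exact Nat.le_findGreatest h2.card_le ⟨d', h1, h2, h3⟩
  generalize Nat.findGreatest P S.card = t₀ at hPg hPmax
  obtain ⟨d₀, hd, hcf, he⟩ := hPg
  obtain ⟨𝒯, R, X, hconf, rfl, rfl⟩ := hcf.conf
  have hopt : Opt H S 𝒯.card R.card := by
    refine ⟨fun t' d' h => ?_, fun t' d' h h' => ?_⟩
    · have := hSB _ _ h
      omega
    · by_contra hlt'
      exact hlt' (hPmax t' ⟨d', by omega, h, by omega⟩)
  obtain ⟨u, hu, K, hK, huK, hind, hle⟩ := key hpart hdom hconf hopt (Finset.card_pos.1 hd)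
  exact ⟨S, u, hu, K, hK, huK, hind, by omega⟩

lemma le_gammaLocal {V : Type*} [Fintype V] (G : SimpleGraph V) (v : V) :
    gammaLocalAt G v ≤ gammaLocal G := by
  apply le_csSup
  · have : {n | ∃ v : V, n = gammaLocalAt G v} = Set.range (gammaLocalAt G) := by
      ext n
      simp [eq_comm]
    rw [this]
    exact (Set.finite_range _).bddAbove
  · exact ⟨v, rfl⟩

lemma le_omegaAt {V : Type*} [Fintype V] (G : SimpleGraph V) (v : V) (K : Finset V)
    (hK : G.IsClique (↑K : Set V)) (hv : v ∈ K) : K.card ≤ omegaAt G v := by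
  apply le_csSup
  · refine ⟨Fintype.card V, ?_⟩
    rintro n ⟨s, hs, -⟩
    rw [← hs.card_eq]
    exact Finset.card_le_univ s
  · exact ⟨K, ⟨hK, rfl⟩, hv⟩

lemma le_degree' {V : Type*} [Fintype V] (G : SimpleGraph V) (S : Finset V) (u : V) (hu : u ∈ S) :
    S.card ≤ degree' G u + 1 + (nb Gᶜ S u).card := by
  have h1 : S ⊆ insert u ((G.neighborSet u).toFinset ∪ nb Gᶜ S u) := by
    intro x hx
    by_cases hxu : x = u
    · simp [hxu]
    · by_cases ha : G.Adj u x
      · simp [ha]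
      · simp [mem_nb, hx, ha, Ne.symm hxu]
  have h2 := Finset.card_le_card h1
  have h3 := Finset.card_insert_le u ((G.neighborSet u).toFinset ∪ nb Gᶜ S u)
  have h4 := Finset.card_union_le (G.neighborSet u).toFinset (nb Gᶜ S u)
  have h5 : degree' G u = (G.neighborSet u).toFinset.card := Set.ncard_eq_toFinset_card' _
  omega

lemma main_aux {V : Type*} [Fintype V] (G : SimpleGraph V) (hcf : ClawFree G)
    (A B C : Finset V)
    (hclA : G.IsClique (↑A : Set V)) (hclB : G.IsClique (↑B : Set V))
    (hclC : G.IsClique (↑C : Set V))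
    (huniv : ∀ x, x ∈ A ∨ x ∈ B ∨ x ∈ C) :
    G.chromaticNumber ≤ (gammaLocal G : ℕ∞) := by
  by_cases hbad : ∀ t d, Cfg Gᶜ Finset.univ t d →
      2 * gammaLocal G + 2 + t ≤ (Finset.univ : Finset V).card + d
  · exfalso
    obtain ⟨S, u, hu, K, hK, huK, hind, hle⟩ := exists_core (H := Gᶜ)
      (part := fun x => if x ∈ A then 0 else if x ∈ B then 1 else 2) (by
        intro x y hxy he
        rw [SimpleGraph.compl_adj] at hxy
        obtain ⟨hne, hna⟩ := hxy
        have a1 := fun h h' => hna (hclA (x := x) (y := y) h h' hne)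
        have a2 := fun h h' => hna (hclB (x := x) (y := y) h h' hne)
        have a3 := fun h h' => hna (hclC (x := x) (y := y) h h' hne)
        have u1 := huniv x
        have u2 := huniv y
        simp only [Finset.mem_coe] at a1 a2 a3
        split_ifs at he <;> first | (exact absurd he (by decide)) | tauto) (by
        intro x y z w hxy hxz hyz h1 h2 h3
        simp only [SimpleGraph.compl_adj] at *
        by_contra hcon
        push Not at hcon
        exact hcf ⟨w, x, y, z, hcon.1 h1, hcon.2.1 h2, hcon.2.2 h3, hxy.2, hxz.2, hyz.2,
          hxy.1, hxz.1, hyz.1⟩) _ hbad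
    have hcl : G.IsClique (↑K : Set V) := by
      intro x hx y hy hne
      by_contra hna
      exact hind x hx y hy ((SimpleGraph.compl_adj _ _ _).2 ⟨hne, hna⟩)
    have h1 := le_omegaAt G u K hcl huK
    have h2 := le_degree' G S u hu
    have h3 := le_gammaLocal G u
    unfold gammaLocalAt at h3
    omega
  · simp only [not_forall, not_le] at hbad
    obtain ⟨t, d, hcfg, hlt⟩ := hbad
    obtain ⟨m, hm, c, hc1, hc2⟩ := hcfg.colour
    have hcol : G.Colorable (gammaLocal G) := by
      refine ⟨SimpleGraph.Coloring.mk
        (fun x => (⟨c x, lt_of_lt_of_le (hc1 x (Finset.mem_univ _)) (by omega)⟩ :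
          Fin (gammaLocal G))) ?_⟩
      intro x y hxy he
      have he' : c x = c y := congrArg Fin.val he
      exact ((SimpleGraph.compl_adj _ _ _).1
        (hc2 x (Finset.mem_univ _) y (Finset.mem_univ _) hxy.ne he')).2 hxy
    exact hcol.chromaticNumber_le

end Aux

theorem stmt1 {V : Type*} [Fintype V] [DecidableEq V] (G : SimpleGraph V) (hcf : ClawFree G)
    (A B C : Finset V)
    (hclA : G.IsClique (↑A : Set V)) (hclB : G.IsClique (↑B : Set V))
    (hclC : G.IsClique (↑C : Set V))
    (hdAB : Disjoint A B) (hdAC : Disjoint A C) (hdBC : Disjoint B C)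
    (huniv : A ∪ B ∪ C = Finset.univ) :
    G.chromaticNumber ≤ (gammaLocal G : ℕ∞) := by
  exact main_aux G hcf A B C hclA hclB hclC (fun x => by
    have h : x ∈ A ∪ B ∪ C := by
      rw [huniv]
      exact Finset.mem_univ x
    simpa [or_assoc] using h)

end Paper
end

section
/- Let G be a finite simple graph and (A,B) a nonskeletal homogeneous pair of cliques in G. Then one can delete a nonempty set of edges of G, each with one end in A and the other in B, to obtain a proper spanning subgraph G' of G such that: (A,B) is a skeletal homogeneous pair of cliques in G'; if G is claw-free then G' is claw-free; if G is quasi-line then G' is quasi-line; χ(G') = χ(G); and if the complement of G is 3-colourable then the complement of G' is 3-colourable. -/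
open SimpleGraph

namespace Paper

variable {V : Type*} {W : Type*}

/-! ### Proof of the theorem -/

/-- The setting of the proof: `X` is a maximum clique of `G[A ∪ B]`, and `H` arises from `G` by
deleting all edges between `A` and `B` that are not inside `X`. -/
structure Red (G H : SimpleGraph V) (A B X : Finset V) : Prop where
  clA : G.IsClique (↑A : Set V)
  clB : G.IsClique (↑B : Set V)
  neA : A.Nonempty
  neB : B.Nonempty
  disj : ∀ v, v ∈ A → v ∉ B
  hom : ∀ v, v ∉ A → v ∉ B →
      ((∀ a ∈ A, G.Adj v a) ∨ (∀ a ∈ A, ¬G.Adj v a)) ∧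
      ((∀ b ∈ B, G.Adj v b) ∨ (∀ b ∈ B, ¬G.Adj v b))
  subX : ∀ v ∈ X, v ∈ A ∨ v ∈ B
  clX : G.IsClique (↑X : Set V)
  maxX : ∀ s : Finset V, (∀ v ∈ s, v ∈ A ∨ v ∈ B) → G.IsClique (↑s : Set V) → s.card ≤ X.card
  altX : X = A ∨ X = B ∨ (A.card < X.card ∧ B.card < X.card)
  adj : ∀ u v, H.Adj u v ↔ (G.Adj u v ∧ ¬(u ∈ A ∧ v ∈ B ∧ ¬(u ∈ X ∧ v ∈ X)) ∧
      ¬(v ∈ A ∧ u ∈ B ∧ ¬(u ∈ X ∧ v ∈ X)))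

theorem Red.symm {G H : SimpleGraph V} {A B X : Finset V} (h : Red G H A B X) :
    Red G H B A X where
  clA := h.clB
  clB := h.clA
  neA := h.neB
  neB := h.neA
  disj := fun v hv hv' => h.disj v hv' hv
  hom := fun v hv hv' => (h.hom v hv' hv).symm
  subX := fun v hv => (h.subX v hv).symm
  clX := h.clX
  maxX := fun s hs => h.maxX s (fun v hv => (hs v hv).symm)
  altX := by have := h.altX; tauto
  adj := fun u v => by rw [h.adj]; tauto

/-- Off `A`-`B` pairs, the graphs agree. -/
theorem Red.le {G H : SimpleGraph V} {A B X : Finset V} (h : Red G H A B X) : H ≤ G :=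
  fun u v huv => ((h.adj u v).1 huv).1

theorem Red.clAH {G H : SimpleGraph V} {A B X : Finset V} (h : Red G H A B X) :
    H.IsClique (↑A : Set V) := by
  intro u hu v hv huv
  have h1 := h.clA hu hv huv
  have h2 := h.disj u hu
  have h3 := h.disj v hv
  rw [h.adj]; tauto

theorem Red.clXH {G H : SimpleGraph V} {A B X : Finset V} (h : Red G H A B X) :
    H.IsClique (↑X : Set V) := by
  intro u hu v hv huv
  have h1 := h.clX hu hv huv
  have hu' : u ∈ X := hu
  have hv' : v ∈ X := hv
  rw [h.adj]; tauto

theorem Red.outside {G H : SimpleGraph V} {A B X : Finset V} (h : Red G H A B X) {u v : V}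
    (hA : u ∉ A) (hB : u ∉ B) : H.Adj u v ↔ G.Adj u v := by
  rw [h.adj]; tauto

theorem Red.outside' {G H : SimpleGraph V} {A B X : Finset V} (h : Red G H A B X) {u v : V}
    (hA : v ∉ A) (hB : v ∉ B) : H.Adj u v ↔ G.Adj u v := by
  rw [h.adj]; tauto

/-- Either nothing was deleted or there is a nonadjacent pair in `G`. -/
theorem Red.eq_or {G H : SimpleGraph V} {A B X : Finset V} (h : Red G H A B X) :
    H = G ∨ ∃ a ∈ A, ∃ b ∈ B, ¬ G.Adj a b := by
  classical
  by_cases hc : ∃ a ∈ A, ∃ b ∈ B, ¬ G.Adj a b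
  · exact Or.inr hc
  left
  push Not at hc
  have hcl : G.IsClique (↑(A ∪ B) : Set V) := by
    intro u hu v hv huv
    have hu : u ∈ A ∪ B := hu
    have hv : v ∈ A ∪ B := hv
    rw [Finset.mem_union] at hu hv
    rcases hu with hu | hu <;> rcases hv with hv | hv
    · exact h.clA hu hv huv
    · exact hc u hu v hv
    · exact (hc v hv u hu).symm
    · exact h.clB hu hv huv
  have hle := h.maxX (A ∪ B) (fun v hv => Finset.mem_union.1 hv) hcl
  have hXs : X ⊆ A ∪ B := fun v hv => Finset.mem_union.2 (h.subX v hv)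
  have hX : X = A ∪ B := Finset.eq_of_subset_of_card_le hXs hle
  ext u v
  rw [h.adj, hX]
  simp only [Finset.mem_union]
  tauto

/-- A clique made of `A` and outside vertices complete to `A`. -/
theorem Red.clique_add {G H : SimpleGraph V} {A B X : Finset V} (h : Red G H A B X)
    {S : Set V} (hS : G.IsClique S) {a : V} (ha : a ∈ A) {Y : Set V}
    (hY : H.IsClique Y) (hYA : ∀ y ∈ Y, y ∈ A)
    (haS : ∀ v ∈ S, v ∉ A → v ∉ B → G.Adj v a) :
    H.IsClique (Y ∪ {v | v ∈ S ∧ v ∉ A ∧ v ∉ B}) := by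
  have key : ∀ v ∈ S, v ∉ A → v ∉ B → ∀ y ∈ A, H.Adj v y := by
    intro v hv hvA hvB y hy
    rw [h.outside hvA hvB]
    rcases (h.hom v hvA hvB).1 with h1 | h1
    · exact h1 y hy
    · exact absurd (haS v hv hvA hvB) (h1 a ha)
  rintro u (hu | ⟨hu, huA, huB⟩) v (hv | ⟨hv, hvA, hvB⟩) huv
  · exact hY hu hv huv
  · exact (key v hv hvA hvB u (hYA u hu)).symm
  · exact key u hu huA huB v (hYA v hv)
  · rw [h.outside huA huB]; exact hS hu hv huv

theorem Red.mem_clique {G H : SimpleGraph V} {A B X : Finset V} (_h : Red G H A B X)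
    {S : Set V} (hS : G.IsClique S) {a : V} (ha : a ∈ A) (haS : a ∈ S) :
    ∀ v ∈ S, v ∉ A → v ∉ B → G.Adj v a := by
  intro v hv hvA _
  exact hS hv haS (fun e => hvA (e ▸ ha))

/-- Preservation of claw-freeness, for a claw containing a deleted pair. -/
theorem Red.claw_aux {G H : SimpleGraph V} {A B X : Finset V} (h : Red G H A B X)
    (hG : ClawFree G) {v a b c : V} (hva : H.Adj v a) (hvb : H.Adj v b) (hvc : H.Adj v c)
    (hac : ¬ H.Adj a c) (hbc : ¬ H.Adj b c) (nac : a ≠ c) (nbc : b ≠ c)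
    (hab : ¬ H.Adj a b) (gab : G.Adj a b) (ha : a ∈ A) (hb : b ∈ B) : False := by
  have hcA : c ∉ A := fun hc => hac (h.clAH ha hc nac)
  have hcB : c ∉ B := fun hc => hbc (h.symm.clAH hb hc nbc)
  have hcA' : ∀ y ∈ A, ¬ G.Adj c y := by
    rcases (h.hom c hcA hcB).1 with h1 | h1
    · exact absurd ((h.outside hcA hcB).2 (h1 a ha)).symm hac
    · exact h1
  have hcB' : ∀ y ∈ B, ¬ G.Adj c y := by
    rcases (h.hom c hcA hcB).2 with h1 | h1
    · exact absurd ((h.outside hcA hcB).2 (h1 b hb)).symm hbc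
    · exact h1
  have hvA : v ∉ A := fun hv => hcA' v hv (h.le hvc).symm
  have hvB : v ∉ B := fun hv => hcB' v hv (h.le hvc).symm
  have hvA' : ∀ y ∈ A, G.Adj v y := by
    rcases (h.hom v hvA hvB).1 with h1 | h1
    · exact h1
    · exact absurd (h.le hva) (h1 a ha)
  have hvB' : ∀ y ∈ B, G.Adj v y := by
    rcases (h.hom v hvA hvB).2 with h1 | h1
    · exact h1
    · exact absurd (h.le hvb) (h1 b hb)
  rcases h.eq_or with he | ⟨x, hx, y, hy, hxy⟩
  · rw [he] at hab; exact hab gab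
  · exact hG ⟨v, x, y, c, hvA' x hx, hvB' y hy, h.le hvc, hxy,
      fun q => hcA' x hx q.symm, fun q => hcB' y hy q.symm,
      fun e => h.disj x hx (e ▸ hy), fun e => hcA (e ▸ hx), fun e => hcB (e ▸ hy)⟩

theorem Red.lost {G H : SimpleGraph V} {A B X : Finset V} (h : Red G H A B X) {u v : V}
    (g : G.Adj u v) (n : ¬ H.Adj u v) : (u ∈ A ∧ v ∈ B) ∨ (u ∈ B ∧ v ∈ A) := by
  rw [h.adj] at n; tauto

theorem Red.claw_aux' {G H : SimpleGraph V} {A B X : Finset V} (h : Red G H A B X)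
    (hG : ClawFree G) {v a b c : V} (hva : H.Adj v a) (hvb : H.Adj v b) (hvc : H.Adj v c)
    (hac : ¬ H.Adj a c) (hbc : ¬ H.Adj b c) (nac : a ≠ c) (nbc : b ≠ c)
    (hab : ¬ H.Adj a b) : ¬ G.Adj a b := by
  intro gab
  rcases h.lost gab hab with ⟨ha, hb⟩ | ⟨ha, hb⟩
  · exact h.claw_aux hG hva hvb hvc hac hbc nac nbc hab gab ha hb
  · exact h.symm.claw_aux hG hva hvb hvc hac hbc nac nbc hab gab ha hb

theorem Red.clawFree {G H : SimpleGraph V} {A B X : Finset V} (h : Red G H A B X)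
    (hG : ClawFree G) : ClawFree H := by
  rintro ⟨v, a, b, c, hva, hvb, hvc, hab, hac, hbc, nab, nac, nbc⟩
  have sy : ∀ {x y : V}, ¬ H.Adj x y → ¬ H.Adj y x := fun n q => n q.symm
  refine hG ⟨v, a, b, c, h.le hva, h.le hvb, h.le hvc, ?_, ?_, ?_, nab, nac, nbc⟩
  · exact h.claw_aux' hG hva hvb hvc hac hbc nac nbc hab
  · exact h.claw_aux' hG hva hvc hvb hab (sy hbc) nab nbc.symm hac
  · exact h.claw_aux' hG hvb hvc hva (sy hab) (sy hac) nab.symm nac.symm hbc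

/-- Complement colourings. -/
theorem Red.compl {G H : SimpleGraph V} {A B X : Finset V} (h : Red G H A B X)
    (hG : Gᶜ.Colorable 3) : Hᶜ.Colorable 3 := by
  classical
  rcases h.eq_or with he | ⟨x, hx, y, hy, hxy⟩
  · rwa [he]
  obtain ⟨c⟩ := hG
  have nxy : x ≠ y := fun e => h.disj x hx (e ▸ hy)
  have hcxy : c x ≠ c y := c.valid (by rw [SimpleGraph.compl_adj]; exact ⟨nxy, hxy⟩)
  have hcl : ∀ i, G.IsClique {v | c v = i} := by
    intro i u hu v hv huv
    by_contra hn
    exact c.valid (v := u) (w := v) (by rw [SimpleGraph.compl_adj]; exact ⟨huv, hn⟩)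
      (hu.trans hv.symm)
  have k1 := h.clique_add (hcl (c x)) hx h.clAH (fun y hy => hy)
    (h.mem_clique (hcl (c x)) hx rfl)
  have k2 := h.symm.clique_add (hcl (c y)) hy h.symm.clAH (fun y hy => hy)
    (h.symm.mem_clique (hcl (c y)) hy rfl)
  refine ⟨SimpleGraph.Coloring.mk
    (fun v => if v ∈ A then c x else if v ∈ B then c y else c v) ?_⟩
  intro u v huv heq
  rw [SimpleGraph.compl_adj] at huv
  obtain ⟨huv, hn⟩ := huv
  apply hn
  by_cases e1 : (if u ∈ A then c x else if u ∈ B then c y else c u) = c x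
  · rw [e1] at heq
    refine k1 ?_ ?_ huv
    · split_ifs at e1 with q1 q2
      · exact Or.inl q1
      · exact absurd e1.symm hcxy
      · exact Or.inr ⟨e1, q1, q2⟩
    · split_ifs at heq with q1 q2
      · exact Or.inl q1
      · exact absurd heq hcxy
      · exact Or.inr ⟨heq.symm, q1, q2⟩
  · by_cases e2 : (if u ∈ A then c x else if u ∈ B then c y else c u) = c y
    · rw [e2] at heq
      refine k2 ?_ ?_ huv
      · split_ifs at e2 with q1 q2
        · exact absurd e2 hcxy
        · exact Or.inl q2
        · exact Or.inr ⟨e2, q2, q1⟩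
      · split_ifs at heq with q1 q2
        · exact absurd heq.symm hcxy
        · exact Or.inl q2
        · exact Or.inr ⟨heq.symm, q2, q1⟩
    · have hu : u ∉ A ∧ u ∉ B := by
        constructor <;> intro q
        · simp [q] at e1
        · have := h.symm.disj u q
          simp [q, this] at e2
      rw [h.outside hu.1 hu.2]
      simp only [hu.1, hu.2, if_false] at heq e1 e2
      split_ifs at heq
      · exact absurd heq e1
      · exact absurd heq e2
      · exact hcl (c u) rfl heq.symm huv

/-- Cliques of `G` missing `B` are cliques of `H`. -/
theorem Red.clique_of_missB {G H : SimpleGraph V} {A B X : Finset V} (h : Red G H A B X)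
    {S : Set V} (hS : G.IsClique S) (hB : ∀ v ∈ S, v ∉ B) : H.IsClique S := by
  intro u hu v hv huv
  have h1 := hS hu hv huv
  have := hB u hu
  have := hB v hv
  rw [h.adj]; tauto

theorem Red.ql_miss {G H : SimpleGraph V} {A B X : Finset V} (h : Red G H A B X)
    (hG : QuasiLine G) {v : V} (hB : ∀ w, H.Adj v w → w ∉ B) :
    ∃ S T : Set V, H.IsClique S ∧ H.IsClique T ∧ H.neighborSet v ⊆ S ∪ T := by
  obtain ⟨S, T, hS, hT, hST⟩ := hG v
  refine ⟨S ∩ H.neighborSet v, T ∩ H.neighborSet v,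
    h.clique_of_missB (hS.subset Set.inter_subset_left) (fun w hw => hB w hw.2),
    h.clique_of_missB (hT.subset Set.inter_subset_left) (fun w hw => hB w hw.2), ?_⟩
  intro w hw
  rcases hST (h.le hw) with q | q
  · exact Or.inl ⟨q, hw⟩
  · exact Or.inr ⟨q, hw⟩

theorem Red.ql_inA {G H : SimpleGraph V} {A B X : Finset V} (h : Red G H A B X)
    (hG : QuasiLine G) {v : V} (hv : v ∈ A) :
    ∃ S T : Set V, H.IsClique S ∧ H.IsClique T ∧ H.neighborSet v ⊆ S ∪ T := by
  by_cases hB : ∀ w, H.Adj v w → w ∉ B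
  · exact h.ql_miss hG hB
  push Not at hB
  obtain ⟨y, hvy, hy⟩ := hB
  have main : ∀ S T : Set V, G.IsClique S → G.IsClique T → G.neighborSet v ⊆ S ∪ T → y ∈ S →
      ∃ S T : Set V, H.IsClique S ∧ H.IsClique T ∧ H.neighborSet v ⊆ S ∪ T := by
    intro S T hS hT hST hyS
    have hYcl : H.IsClique {w | w ∈ B ∧ H.Adj v w} :=
      h.symm.clAH.subset (fun w hw => hw.1)
    have k1 := h.symm.clique_add hS hy hYcl (fun w hw => hw.1)
      (h.symm.mem_clique hS hy hyS)
    have k2 := h.clique_add (S := T ∩ G.neighborSet v) (hT.subset Set.inter_subset_left) hv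
      h.clAH (fun w hw => hw) (fun w hw _ _ => (show G.Adj v w from hw.2).symm)
    refine ⟨_, _, k1, k2, ?_⟩
    intro w hw
    by_cases hwA : w ∈ A
    · exact Or.inr (Or.inl hwA)
    by_cases hwB : w ∈ B
    · exact Or.inl (Or.inl ⟨hwB, hw⟩)
    rcases hST (h.le hw) with q | q
    · exact Or.inl (Or.inr ⟨q, hwB, hwA⟩)
    · exact Or.inr (Or.inr ⟨⟨q, h.le hw⟩, hwA, hwB⟩)
  obtain ⟨S, T, hS, hT, hST⟩ := hG v
  rcases hST (h.le hvy) with q | q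
  · exact main S T hS hT hST q
  · exact main T S hT hS (by rwa [Set.union_comm]) q

theorem Red.quasiLine {G H : SimpleGraph V} {A B X : Finset V} (h : Red G H A B X)
    (hG : QuasiLine G) : QuasiLine H := by
  intro v
  by_cases hvA : v ∈ A
  · exact h.ql_inA hG hvA
  by_cases hvB : v ∈ B
  · exact h.symm.ql_inA hG hvB
  rcases (h.hom v hvA hvB).1 with fA | fA
  swap
  · exact h.symm.ql_miss hG (fun w hw hwA => fA w hwA (h.le hw))
  rcases (h.hom v hvA hvB).2 with fB | fB
  swap
  · exact h.ql_miss hG (fun w hw hwB => fB w hwB (h.le hw))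
  rcases h.eq_or with he | ⟨x, hx, y, hy, hxy⟩
  · rw [he]; exact hG v
  have nxy : x ≠ y := fun e => h.disj x hx (e ▸ hy)
  have main : ∀ S T : Set V, G.IsClique S → G.IsClique T → G.neighborSet v ⊆ S ∪ T → x ∈ S →
      ∃ S T : Set V, H.IsClique S ∧ H.IsClique T ∧ H.neighborSet v ⊆ S ∪ T := by
    intro S T hS hT hST hxS
    have hyT : y ∈ T := by
      rcases hST (fB y hy) with q | q
      · exact absurd (hS hxS q nxy) hxy
      · exact q
    have k1 := h.clique_add hS hx h.clAH (fun y hy => hy) (h.mem_clique hS hx hxS)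
    have k2 := h.symm.clique_add hT hy h.symm.clAH (fun y hy => hy)
      (h.symm.mem_clique hT hy hyT)
    refine ⟨_, _, k1, k2, ?_⟩
    intro w hw
    by_cases hwA : w ∈ A
    · exact Or.inl (Or.inl hwA)
    by_cases hwB : w ∈ B
    · exact Or.inr (Or.inl hwB)
    rcases hST (h.le hw) with q | q
    · exact Or.inl (Or.inr ⟨q, hwA, hwB⟩)
    · exact Or.inr (Or.inr ⟨q, hwB, hwA⟩)
  obtain ⟨S, T, hS, hT, hST⟩ := hG v
  rcases hST (fA x hx) with q | q
  · exact main S T hS hT hST q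
  · exact main T S hT hS (by rwa [Set.union_comm]) q

/-- The clique number on a set is attained. -/
theorem cliqueNumOn_mem [Fintype V] (G : SimpleGraph V) (S : Set V) :
    ∃ s : Finset V, ↑s ⊆ S ∧ G.IsNClique (cliqueNumOn G S) s := by
  have hne : {n | ∃ s : Finset V, ↑s ⊆ S ∧ G.IsNClique n s}.Nonempty :=
    ⟨0, ∅, by simp, by simp⟩
  have hb : BddAbove {n | ∃ s : Finset V, ↑s ⊆ S ∧ G.IsNClique n s} := by
    refine ⟨Fintype.card V, ?_⟩
    rintro n ⟨s, _, hs⟩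
    rw [← hs.card_eq]
    exact Finset.card_le_univ s
  exact Nat.sSup_mem hne hb

theorem le_cliqueNumOn [Fintype V] (G : SimpleGraph V) (S : Set V) (s : Finset V)
    (hs : ↑s ⊆ S) (hc : G.IsClique (↑s : Set V)) : s.card ≤ cliqueNumOn G S := by
  have hb : BddAbove {n | ∃ s : Finset V, ↑s ⊆ S ∧ G.IsNClique n s} := by
    refine ⟨Fintype.card V, ?_⟩
    rintro n ⟨s, _, hs⟩
    rw [← hs.card_eq]
    exact Finset.card_le_univ s
  exact le_csSup hb ⟨s, hs, hc, rfl⟩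

theorem Red.skel {G H : SimpleGraph V} {A B X : Finset V} [Fintype V] (h : Red G H A B X) :
    IsSkeletalPair H A B := by
  classical
  intro a ha b hb hab
  have hX : a ∈ X ∧ b ∈ X := by
    by_contra hn
    rw [h.adj] at hab
    tauto
  have hcard : A.card < X.card ∧ B.card < X.card := by
    rcases h.altX with e | e | e
    · exact absurd hb (h.disj b (e ▸ hX.2))
    · exact absurd (e ▸ hX.1) (h.disj a ha)
    · exact e
  have hle : X.card ≤ cliqueNumOn H (↑A ∪ ↑B) :=
    le_cliqueNumOn H _ X (fun v hv => h.subX v hv) h.clXH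
  refine lt_of_lt_of_le ?_ hle
  obtain ⟨s, hs, hcl⟩ := cliqueNumOn_mem (H.deleteEdges {s(a, b)}) (↑A ∪ ↑B)
  rw [← hcl.card_eq]
  have hcl' := hcl.isClique
  have hsH : ∀ u ∈ s, ∀ v ∈ s, u ≠ v → H.Adj u v := fun u hu v hv huv =>
    (SimpleGraph.deleteEdges_le _) (hcl' hu hv huv)
  by_cases h1 : s ⊆ A
  · exact (Finset.card_le_card h1).trans_lt hcard.1
  by_cases h2 : s ⊆ B
  · exact (Finset.card_le_card h2).trans_lt hcard.2
  rw [Finset.not_subset] at h1 h2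
  obtain ⟨q, hq, hqA⟩ := h1
  obtain ⟨p, hp, hpB⟩ := h2
  have hqB : q ∈ B := (hs hq).resolve_left hqA
  have hpA : p ∈ A := (hs hp).resolve_right hpB
  apply Finset.card_lt_card
  rw [Finset.ssubset_iff_of_subset]
  · by_cases has : a ∈ s
    · refine ⟨b, hX.2, fun hbs => ?_⟩
      have := hcl' has hbs hab.ne
      simp [SimpleGraph.deleteEdges_adj] at this
    · exact ⟨a, hX.1, has⟩
  · intro u hu
    rcases hs hu with huA | huB
    · have huA : u ∈ A := huA
      have := (h.adj u q).1 (hsH u hu q hq (fun e => hqA (e ▸ huA)))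
      tauto
    · have huB : u ∈ B := huB
      have := (h.adj u p).1 (hsH u hu p hp (fun e => hpB (e ▸ huB)))
      tauto

/-- König-type step: if every clique of `G[A ∪ B]` has at most `|A| + |B| - s` vertices then the
nonadjacent pairs between `A` and `B` contain a matching of size `s`. -/
theorem exists_antimatching (G : SimpleGraph V) (A B : Finset V)
    (clA : G.IsClique (↑A : Set V)) (clB : G.IsClique (↑B : Set V))
    (disj : ∀ v, v ∈ A → v ∉ B) (s : ℕ) (hsA : s ≤ A.card)
    (hmax : ∀ t : Finset V, (∀ v ∈ t, v ∈ A ∨ v ∈ B) → G.IsClique (↑t : Set V) →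
      t.card + s ≤ A.card + B.card) :
    ∃ (f : Fin s → A) (g : Fin s → B), Function.Injective f ∧ Function.Injective g ∧
      ∀ i, ¬ G.Adj (f i) (g i) := by
  classical
  let N : A → Finset (B ⊕ Fin (A.card - s)) := fun a =>
    Finset.univ.filter (fun z => ∀ b, z = Sum.inl b → ¬ G.Adj a b)
  have hall : ∀ S : Finset A, S.card ≤ (S.biUnion N).card := by
    intro S
    rcases S.eq_empty_or_nonempty with rfl | ⟨a₀, ha₀⟩
    · simp
    let C : Finset B := Finset.univ.filter (fun b : B => ∀ a ∈ S, G.Adj (a : V) b)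
    have e1 : (S.map (Function.Embedding.subtype _) ∪
        C.map (Function.Embedding.subtype _)).card = S.card + C.card := by
      rw [Finset.card_union_of_disjoint, Finset.card_map, Finset.card_map]
      rw [Finset.disjoint_left]
      intro v hv hv'
      simp only [Finset.mem_map, Function.Embedding.subtype_apply] at hv hv'
      obtain ⟨x, _, rfl⟩ := hv
      obtain ⟨y, _, hy⟩ := hv'
      exact disj x x.2 (hy ▸ y.2)
    have e2 := hmax (S.map (Function.Embedding.subtype _) ∪
        C.map (Function.Embedding.subtype _)) (by
          intro v hv
          simp only [Finset.mem_union, Finset.mem_map, Function.Embedding.subtype_apply] at hv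
          rcases hv with ⟨x, _, rfl⟩ | ⟨x, _, rfl⟩
          · exact Or.inl x.2
          · exact Or.inr x.2) (by
          intro u hu v hv huv
          simp only [Finset.coe_union, Finset.coe_map, Function.Embedding.subtype_apply,
            Set.mem_union, Set.mem_image, Finset.mem_coe] at hu hv
          rcases hu with ⟨x, hx, rfl⟩ | ⟨x, hx, rfl⟩ <;> rcases hv with ⟨y, hy, rfl⟩ | ⟨y, hy, rfl⟩
          · exact clA x.2 y.2 huv
          · exact (Finset.mem_filter.1 hy).2 x hx
          · exact ((Finset.mem_filter.1 hx).2 y hy).symm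
          · exact clB x.2 y.2 huv)
    rw [e1] at e2
    have e3 : (Cᶜ.disjSum (Finset.univ : Finset (Fin (A.card - s)))) ⊆ S.biUnion N := by
      intro z hz
      rw [Finset.mem_biUnion]
      rcases z with b | d
      · have hb : b ∉ C := by simpa using hz
        simp only [C, Finset.mem_filter, Finset.mem_univ, true_and] at hb
        push Not at hb
        obtain ⟨a, ha, hab⟩ := hb
        refine ⟨a, ha, ?_⟩
        simp only [N, Finset.mem_filter, Finset.mem_univ, true_and]
        rintro b' hb'
        cases hb'
        exact hab
      · refine ⟨a₀, ha₀, ?_⟩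
        simp [N]
    have e4 := Finset.card_le_card e3
    rw [Finset.card_disjSum, Finset.card_compl, Finset.card_univ, Fintype.card_fin,
      Fintype.card_coe] at e4
    have e5 : C.card ≤ B.card := by
      have := Finset.card_le_univ C
      rwa [Fintype.card_coe] at this
    omega
  obtain ⟨m, minj, hm⟩ := (Finset.all_card_le_biUnion_card_iff_exists_injective N).1 hall
  let P : Finset A := Finset.univ.filter (fun a => (m a).isLeft)
  have hP : s ≤ P.card := by
    have h1 : Pᶜ.card ≤ A.card - s := by
      have h2 : Pᶜ.image m ⊆ (Finset.univ : Finset (Fin (A.card - s))).map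
          Function.Embedding.inr := by
        intro z hz
        obtain ⟨a, ha, rfl⟩ := Finset.mem_image.1 hz
        simp only [P, Finset.mem_compl, Finset.mem_filter, Finset.mem_univ, true_and] at ha
        rcases hma : m a with b | d
        · rw [hma] at ha; simp at ha
        · simp
      have h3 := Finset.card_le_card h2
      rw [Finset.card_image_of_injective _ minj, Finset.card_map, Finset.card_univ,
        Fintype.card_fin] at h3
      exact h3
    rw [Finset.card_compl, Fintype.card_coe] at h1
    omega
  have hex : ∀ p : P, ∃ b : B, m p = Sum.inl b := by
    intro p
    have hp := (Finset.mem_filter.1 p.2).2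
    rcases hma : m p with b | d
    · exact ⟨b, rfl⟩
    · rw [hma] at hp; simp at hp
  choose g hg using hex
  obtain ⟨k⟩ : Nonempty (Fin s ↪ P) := by
    apply Function.Embedding.nonempty_of_card_le
    simpa using hP
  refine ⟨fun i => (k i : A), fun i => g (k i), ?_, ?_, ?_⟩
  · exact Subtype.val_injective.comp k.injective
  · intro i j hij
    apply k.injective
    apply Subtype.val_injective
    apply minj
    rw [hg, hg]
    exact congrArg Sum.inl hij
  · intro i
    exact (Finset.mem_filter.1 (hm (k i))).2 (g (k i)) (hg (k i))

theorem Red.antimatching {G H : SimpleGraph V} {A B X : Finset V} (h : Red G H A B X) (s : ℕ)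
    (f : Fin s → A) (g : Fin s → B) (hf : Function.Injective f) (hg : Function.Injective g)
    (hfg : ∀ i, ¬ H.Adj (f i) (g i)) :
    ∃ (f : Fin s → A) (g : Fin s → B), Function.Injective f ∧ Function.Injective g ∧
      ∀ i, ¬ G.Adj (f i) (g i) := by
  classical
  have hX : X.card + s ≤ A.card + B.card := by
    let r : Fin s → V := fun i => if (f i : V) ∈ X then g i else f i
    have rinj : Function.Injective r := by
      intro i j hij
      simp only [r] at hij
      split_ifs at hij
      · exact hg (Subtype.val_injective hij)
      · exact absurd (g i).2 (h.disj _ (hij ▸ (f j).2))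
      · exact absurd (g j).2 (h.disj _ (hij ▸ (f i).2))
      · exact hf (Subtype.val_injective hij)
    have hd : Disjoint X (Finset.univ.image r) := by
      rw [Finset.disjoint_right]
      intro v hv hvX
      obtain ⟨i, _, rfl⟩ := Finset.mem_image.1 hv
      simp only [r] at hvX
      split_ifs at hvX with q
      · exact hfg i (h.clXH q hvX (fun e => h.disj _ (f i).2 (e ▸ (g i).2)))
      · exact q hvX
    have hsub : X ∪ Finset.univ.image r ⊆ A ∪ B := by
      intro v hv
      rcases Finset.mem_union.1 hv with hv | hv
      · exact Finset.mem_union.2 (h.subX v hv)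
      · obtain ⟨i, _, rfl⟩ := Finset.mem_image.1 hv
        simp only [r]
        split_ifs
        · exact Finset.mem_union_right _ (g i).2
        · exact Finset.mem_union_left _ (f i).2
    have h1 := Finset.card_le_card hsub
    rw [Finset.card_union_of_disjoint hd, Finset.card_image_of_injective _ rinj,
      Finset.card_univ, Fintype.card_fin] at h1
    exact h1.trans (Finset.card_union_le _ _)
  refine exists_antimatching G A B h.clA h.clB h.disj s ?_ ?_
  · have := Fintype.card_le_of_injective f hf
    simpa using this
  · intro t ht hc
    have := h.maxX t ht hc
    omega

theorem Red.colorable {G H : SimpleGraph V} {A B X : Finset V} (h : Red G H A B X) (n : ℕ)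
    (hH : H.Colorable n) : G.Colorable n := by
  classical
  obtain ⟨c⟩ := hH
  let P : Finset A := Finset.univ.filter (fun a => ∃ b : B, c a = c b)
  have hex : ∀ p : P, ∃ b : B, c p = c b := fun p => (Finset.mem_filter.1 p.2).2
  choose b' hb' using hex
  let k : Fin P.card ≃ P := P.equivFin.symm
  have injA : ∀ u ∈ A, ∀ v ∈ A, c u = c v → u = v := by
    intro u hu v hv e
    by_contra hn
    exact c.valid (h.clAH hu hv hn) e
  have injB : ∀ u ∈ B, ∀ v ∈ B, c u = c v → u = v := by
    intro u hu v hv e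
    by_contra hn
    exact c.valid (h.symm.clAH hu hv hn) e
  let f' : Fin P.card → A := fun i => (k i : A)
  let g' : Fin P.card → B := fun i => b' (k i)
  have hfg' : ∀ i, c (f' i) = c (g' i) := fun i => hb' (k i)
  have hf' : Function.Injective f' := Subtype.val_injective.comp k.injective
  have hg' : Function.Injective g' := by
    intro i j e
    apply hf'
    apply Subtype.val_injective
    apply injA _ (f' i).2 _ (f' j).2
    rw [hfg', hfg', e]
  obtain ⟨f, g, hf, hg, hfg⟩ := h.antimatching _ f' g' hf' hg'
    (fun i hi => c.valid hi (hfg' i))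
  obtain ⟨σ, hσ⟩ := Equiv.Perm.exists_extending_pair f f' hf hf'
  obtain ⟨τ, hτ⟩ := Equiv.Perm.exists_extending_pair g g' hg hg'
  let φ : V → V := fun v => if hv : v ∈ A then σ ⟨v, hv⟩ else if hv : v ∈ B then τ ⟨v, hv⟩ else v
  have φA : ∀ v (hv : v ∈ A), φ v = σ ⟨v, hv⟩ := fun v hv => by simp [φ, hv]
  have φB : ∀ v (hv : v ∈ B), φ v = τ ⟨v, hv⟩ := fun v hv => by
    simp [φ, hv, h.symm.disj v hv]
  have φO : ∀ v, v ∉ A → v ∉ B → φ v = v := fun v hA hB => by simp [φ, hA, hB]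
  -- the key case
  have cross : ∀ u ∈ A, ∀ v ∈ B, G.Adj u v → c (φ u) ≠ c (φ v) := by
    intro u hu v hv huv e
    rw [φA u hu, φB v hv] at e
    have hP : σ ⟨u, hu⟩ ∈ P := Finset.mem_filter.2 ⟨Finset.mem_univ _, _, e⟩
    obtain ⟨i, hi⟩ := k.surjective ⟨_, hP⟩
    have hi1 : f' i = σ ⟨u, hu⟩ := by simp only [f', hi]
    have hi2 : g' i = τ ⟨v, hv⟩ := by
      apply Subtype.val_injective
      apply injB _ (g' i).2 _ (τ ⟨v, hv⟩).2
      rw [← hfg', hi1, e]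
    have hu' : f i = ⟨u, hu⟩ := σ.injective (by rw [← hi1]; exact hσ i)
    have hv' : g i = ⟨v, hv⟩ := τ.injective (by rw [← hi2]; exact hτ i)
    apply hfg i
    rw [hu', hv']
    exact huv
  -- outside vertices
  have out : ∀ u v, u ∉ A → u ∉ B → G.Adj u v → c (φ u) ≠ c (φ v) := by
    intro u v huA huB huv
    rw [φO u huA huB]
    apply c.valid
    rw [h.outside huA huB]
    by_cases hvA : v ∈ A
    · rw [φA v hvA]
      rcases (h.hom u huA huB).1 with q | q
      · exact q _ (σ ⟨v, hvA⟩).2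
      · exact absurd huv (q v hvA)
    by_cases hvB : v ∈ B
    · rw [φB v hvB]
      rcases (h.hom u huA huB).2 with q | q
      · exact q _ (τ ⟨v, hvB⟩).2
      · exact absurd huv (q v hvB)
    rwa [φO v hvA hvB]
  refine ⟨SimpleGraph.Coloring.mk (fun v => c (φ v)) ?_⟩
  intro u v huv
  by_cases huA : u ∈ A
  · by_cases hvA : v ∈ A
    · intro e
      apply huv.ne
      rw [φA u huA, φA v hvA] at e
      have := σ.injective (Subtype.val_injective (injA _ (σ ⟨u, huA⟩).2 _ (σ ⟨v, hvA⟩).2 e))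
      exact congrArg Subtype.val this
    by_cases hvB : v ∈ B
    · exact cross u huA v hvB huv
    · exact (out v u hvA hvB huv.symm).symm
  by_cases huB : u ∈ B
  · by_cases hvA : v ∈ A
    · exact (cross v hvA u huB huv.symm).symm
    by_cases hvB : v ∈ B
    · intro e
      apply huv.ne
      rw [φB u huB, φB v hvB] at e
      have := τ.injective (Subtype.val_injective (injB _ (τ ⟨u, huB⟩).2 _ (τ ⟨v, hvB⟩).2 e))
      exact congrArg Subtype.val this
    · exact (out v u hvA hvB huv.symm).symm
  · exact out u v huA huB huv

/-- The existence of a suitable maximum clique `X`. -/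
theorem exists_maxclique (G : SimpleGraph V) (A B : Finset V)
    (clA : G.IsClique (↑A : Set V)) (clB : G.IsClique (↑B : Set V)) :
    ∃ X : Finset V, (∀ v ∈ X, v ∈ A ∨ v ∈ B) ∧ G.IsClique (↑X : Set V) ∧
      (∀ s : Finset V, (∀ v ∈ s, v ∈ A ∨ v ∈ B) → G.IsClique (↑s : Set V) →
        s.card ≤ X.card) ∧
      (X = A ∨ X = B ∨ (A.card < X.card ∧ B.card < X.card)) := by
  classical
  let K : Finset (Finset V) := (A ∪ B).powerset.filter (fun s => G.IsClique (↑s : Set V))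
  have hA : A ∈ K := Finset.mem_filter.2 ⟨Finset.mem_powerset.2 Finset.subset_union_left, clA⟩
  have hB : B ∈ K := Finset.mem_filter.2 ⟨Finset.mem_powerset.2 Finset.subset_union_right, clB⟩
  obtain ⟨X, hX, hmax⟩ := K.exists_max_image Finset.card ⟨A, hA⟩
  have hmax' : ∀ s : Finset V, (∀ v ∈ s, v ∈ A ∨ v ∈ B) → G.IsClique (↑s : Set V) →
      s.card ≤ X.card := fun s hs hc => hmax s (Finset.mem_filter.2
        ⟨Finset.mem_powerset.2 (fun v hv => Finset.mem_union.2 (hs v hv)), hc⟩)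
  by_cases h1 : A.card < X.card
  · by_cases h2 : B.card < X.card
    · have hX' := Finset.mem_filter.1 hX
      exact ⟨X, fun v hv => Finset.mem_union.1 (Finset.mem_powerset.1 hX'.1 hv), hX'.2, hmax',
        Or.inr (Or.inr ⟨h1, h2⟩)⟩
    · exact ⟨B, fun v hv => Or.inr hv, clB, fun s hs hc => (hmax' s hs hc).trans (not_lt.1 h2),
        Or.inr (Or.inl rfl)⟩
  · exact ⟨A, fun v hv => Or.inl hv, clA, fun s hs hc => (hmax' s hs hc).trans (not_lt.1 h1),
      Or.inl rfl⟩

theorem stmt4 {V : Type*} [Fintype V] (G : SimpleGraph V) (A B : Finset V)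
    (hpair : IsHomPair G A B) (hns : ¬IsSkeletalPair G A B) :
    ∃ F : Set (Sym2 V), F.Nonempty ∧
      (∀ e ∈ F, ∃ a ∈ A, ∃ b ∈ B, G.Adj a b ∧ e = s(a, b)) ∧
      G.deleteEdges F < G ∧
      IsHomPair (G.deleteEdges F) A B ∧
      IsSkeletalPair (G.deleteEdges F) A B ∧
      (ClawFree G → ClawFree (G.deleteEdges F)) ∧
      (QuasiLine G → QuasiLine (G.deleteEdges F)) ∧
      (G.deleteEdges F).chromaticNumber = G.chromaticNumber ∧
      (Gᶜ.Colorable 3 → (G.deleteEdges F)ᶜ.Colorable 3) := by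
  classical
  obtain ⟨-, -, clA, clB, neA, neB, disj, hcard, hom⟩ := hpair
  obtain ⟨X, subX, clX, maxX, altX⟩ := exists_maxclique G A B clA clB
  have disj' : ∀ v, v ∈ A → v ∉ B := fun v hv hv' => Finset.disjoint_left.1 disj hv hv'
  let F : Set (Sym2 V) := {e | ∃ a ∈ A, ∃ b ∈ B, G.Adj a b ∧ ¬(a ∈ X ∧ b ∈ X) ∧ e = s(a, b)}
  have hR : Red G (G.deleteEdges F) A B X := by
    refine ⟨clA, clB, neA, neB, disj', fun v hv hv' => hom v (Set.mem_univ v) hv hv', subX, clX,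
      maxX, altX, ?_⟩
    intro u v
    rw [SimpleGraph.deleteEdges_adj]
    refine and_congr_right (fun huv => ?_)
    rw [← not_or]
    apply not_congr
    constructor
    · rintro ⟨a, ha, b, hb, _, hX, e⟩
      rcases Sym2.eq_iff.1 e with ⟨rfl, rfl⟩ | ⟨rfl, rfl⟩
      · exact Or.inl ⟨ha, hb, hX⟩
      · exact Or.inr ⟨ha, hb, fun q => hX q.symm⟩
    · rintro (⟨ha, hb, hX⟩ | ⟨ha, hb, hX⟩)
      · exact ⟨u, ha, v, hb, huv, hX, rfl⟩
      · exact ⟨v, ha, u, hb, huv.symm, fun q => hX q.symm, Sym2.eq_swap⟩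
  have hne : G.deleteEdges F ≠ G := by
    intro e
    have := hR.skel
    rw [e] at this
    exact hns this
  refine ⟨F, ?_, ?_, lt_of_le_of_ne hR.le hne, ?_, hR.skel, hR.clawFree, hR.quasiLine, ?_,
    hR.compl⟩
  · rw [Set.nonempty_iff_ne_empty]
    intro e
    apply hne
    rw [e, SimpleGraph.deleteEdges_empty]
  · rintro e ⟨a, ha, b, hb, hab, _, rfl⟩
    exact ⟨a, ha, b, hb, hab, rfl⟩
  · refine ⟨Set.subset_univ _, Set.subset_univ _, hR.clAH, hR.symm.clAH, neA, neB, disj, hcard, ?_⟩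
    intro v hv hvA hvB
    have := hom v hv hvA hvB
    simpa only [hR.outside hvA hvB] using this
  · apply le_antisymm
    · exact SimpleGraph.chromaticNumber_mono _ hR.le
    · exact SimpleGraph.chromaticNumber_le_of_forall_imp (fun n hn => hR.colorable n hn)

end Paper
end
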